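/- arXiv:1504.05159 — 8 statements merged into one kernel-verified Lean document; each statement's English description precedes it below -/
import Mathlib

section
/- Let L be a regular suffix-free language over an alphabet Σ and let w, x ∈ Σ⁺ be nonempty words. If the left quotient w⁻¹L is nonempty, then w⁻¹L ≠ (xw)⁻¹L. -/
/-- The left quotient of a language `L` by a word `w`: `w⁻¹L = {x | wx ∈ L}`. -/
def leftQuot {α : Type} (w : List α) (L : Set (List α)) : Set (List α) := {x | w ++ x ∈ L}

/-- The quotient complexity of a language: the number of its distinct left quotients. -/
noncomputable def quotComp {α : Type} (L : Set (List α)) : ℕ :=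
  {K : Set (List α) | ∃ w : List α, K = leftQuot w L}.ncard

/-- A language is suffix-free if `v ∈ L` and `uv ∈ L` imply `u = ε`. -/
def SuffixFree {α : Type} (L : Set (List α)) : Prop :=
  ∀ u v : List α, v ∈ L → u ++ v ∈ L → u = []

/-- The language accepted by a DFA. -/
def acceptsSet {α Q : Type} (M : DFA α Q) : Set (List α) :=
  {w | M.evalFrom M.start w ∈ M.accept}

/-- A language is regular if it is accepted by some DFA with finitely many states. -/
def RegularLang {α : Type} (L : Set (List α)) : Prop :=
  ∃ (Q : Type) (_ : Fintype Q) (M : DFA α Q), acceptsSet M = L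

/-- The language of a state `q` of a DFA. -/
def stateLang {α Q : Type} (M : DFA α Q) (q : Q) : Set (List α) :=
  {w | M.evalFrom q w ∈ M.accept}

/-- A DFA is minimal if every state is reachable and no two distinct states have
the same language. -/
def MinimalDFA {α Q : Type} (M : DFA α Q) : Prop :=
  (∀ q : Q, ∃ w : List α, M.evalFrom M.start w = q) ∧
    ∀ p q : Q, stateLang M p = stateLang M q → p = q

/-- The transition semigroup of a DFA: the transformations induced by nonempty words. -/
def transSemigroup {α Q : Type} (M : DFA α Q) : Set (Q → Q) :=
  {t | ∃ w : List α, w ≠ [] ∧ t = fun q => M.evalFrom q w}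

/-- Product (concatenation) of two languages. -/
def catLang {α : Type} (K L : Set (List α)) : Set (List α) :=
  {w | ∃ u ∈ K, ∃ v ∈ L, w = u ++ v}

/-- Kleene star of a language. -/
def starLang {α : Type} (L : Set (List α)) : Set (List α) :=
  {w | ∃ ws : List (List α), (∀ u ∈ ws, u ∈ L) ∧ w = ws.flatten}

/-- Reversal of a language. -/
def revLang {α : Type} (L : Set (List α)) : Set (List α) := {w | w.reverse ∈ L}

/-- If `L` is a regular suffix-free language and `w, x` are nonempty words with
`w⁻¹L ≠ ∅`, then `w⁻¹L ≠ (xw)⁻¹L`. -/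
theorem stmt0 {α : Type} (L : Set (List α)) (hreg : RegularLang L) (hsf : SuffixFree L)
    (w x : List α) (hw : w ≠ []) (hx : x ≠ []) (hne : leftQuot w L ≠ ∅) :
    leftQuot w L ≠ leftQuot (x ++ w) L := by
  intro h
  obtain ⟨y, hy⟩ := Set.nonempty_iff_ne_empty.mpr hne
  have h2 : y ∈ leftQuot (x ++ w) L := h ▸ hy
  refine hx (hsf x (w ++ y) hy ?_)
  have h3 : (x ++ w) ++ y ∈ L := h2
  rwa [List.append_assoc] at h3
end

section
/- Let L be a regular language with minimal DFA D = (Q_n, Σ, δ, 0, F), where Q_n = {0,…,n−1}, the initial state is 0, and state n−1 is the empty state (its language is ∅). (1) If L is suffix-free, then for every nonempty word w ∈ Σ⁺ the induced transformation δ_w belongs to Bsf(n). (2) Conversely, if D has the empty state n−1, exactly one final state, and δ_w ∈ Bsf(n) for every nonempty word w, then L is suffix-free. -/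
/-- `Bsf n`: transformations `t` of `Q_n = {0,…,n-1}` such that `0` is not in the range
of `t`, `(n-1)t = n-1`, and for every `j ≥ 1` either `0t^j = n-1` or `0t^j ≠ qt^j`
for all `q` with `0 < q < n-1`. -/
def Bsf (n : ℕ) (hn : 0 < n) : Set (Fin n → Fin n) :=
  {t | (∀ q : Fin n, t q ≠ ⟨0, hn⟩) ∧ t ⟨n - 1, by omega⟩ = ⟨n - 1, by omega⟩ ∧
    ∀ j : ℕ, 1 ≤ j →
      (t^[j] ⟨0, hn⟩ = ⟨n - 1, by omega⟩ ∨
        ∀ q : Fin n, 0 < q.val → q.val < n - 1 → t^[j] ⟨0, hn⟩ ≠ t^[j] q)}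

/-- `Vsf n`: members of `Bsf n` such that any two distinct states are either both
mapped to `n-1` or mapped to distinct states. -/
def Vsf (n : ℕ) (hn : 0 < n) : Set (Fin n → Fin n) :=
  {t | t ∈ Bsf n hn ∧ ∀ p q : Fin n, p ≠ q →
    (t p = ⟨n - 1, by omega⟩ ∧ t q = ⟨n - 1, by omega⟩) ∨ t p ≠ t q}

/-- `Wsf n`: members of `Bsf n` that either map `0` to `n-1` or map every
`q` with `1 ≤ q ≤ n-2` to `n-1`. -/
def Wsf (n : ℕ) (hn : 0 < n) : Set (Fin n → Fin n) :=
  {t | t ∈ Bsf n hn ∧ (t ⟨0, hn⟩ = ⟨n - 1, by omega⟩ ∨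
    ∀ q : Fin n, 1 ≤ q.val → q.val ≤ n - 2 → t q = ⟨n - 1, by omega⟩)}

/-- The (unordered) pair `{p,q}` of distinct states of `Q_n \ {0, n-1}` is colliding
in the set `T` of transformations. -/
def Colliding {n : ℕ} (hn : 0 < n) (T : Set (Fin n → Fin n)) (p q : Fin n) : Prop :=
  ∃ t ∈ T, ∃ r : Fin n, 0 < r.val ∧ r.val < n - 1 ∧
    ((t ⟨0, hn⟩ = p ∧ t r = q) ∨ (t ⟨0, hn⟩ = q ∧ t r = p))

/-- The semigroup of transformations generated by `G` under composition:
the least set containing `G` and closed under composition. -/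
def genSG {β : Type} (G : Set (β → β)) : Set (β → β) :=
  ⋂₀ {T : Set (β → β) | G ⊆ T ∧ ∀ f ∈ T, ∀ g ∈ T, (g ∘ f) ∈ T}

/-- Let `M` be a minimal DFA on `Q_n = {0,…,n−1}` with initial state `0` and empty
state `n−1`. (1) If the accepted language is suffix-free, then every nonempty word
induces a transformation in `Bsf n`. (2) Conversely, if `M` has exactly one final
state and every nonempty word induces a transformation in `Bsf n`, then the accepted
language is suffix-free. -/
theorem stmt2 {α : Type} {n : ℕ} (hn : 2 ≤ n) (M : DFA α (Fin n))
    (hstart : M.start = ⟨0, by omega⟩) (hmin : MinimalDFA M)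
    (hempty : stateLang M ⟨n - 1, by omega⟩ = ∅) :
    (SuffixFree (acceptsSet M) →
      ∀ w : List α, w ≠ [] → (fun q => M.evalFrom q w) ∈ Bsf n (by omega)) ∧
    ((∃! q : Fin n, q ∈ M.accept) →
      (∀ w : List α, w ≠ [] → (fun q => M.evalFrom q w) ∈ Bsf n (by omega)) →
      SuffixFree (acceptsSet M)) := by
  have hsub : ∀ (q : Fin n), q ≠ ⟨n - 1, by omega⟩ → ∃ x, M.evalFrom q x ∈ M.accept := by
    intro q hq
    by_contra h
    push Not at h
    apply hq
    apply hmin.2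
    rw [hempty]
    ext x
    simpa [stateLang] using h x
  have hdead : ∀ x, M.evalFrom ⟨n - 1, by omega⟩ x ∉ M.accept := by
    intro x hx
    have : x ∈ stateLang M ⟨n - 1, by omega⟩ := hx
    rw [hempty] at this
    exact this
  have hiter : ∀ (w : List α) (j : ℕ), ∃ W : List α,
      (fun q => M.evalFrom q w)^[j] = fun q => M.evalFrom q W := by
    intro w j
    induction j with
    | zero => exact ⟨[], by ext q; simp⟩
    | succ k ih =>
      obtain ⟨W, hW⟩ := ih
      refine ⟨w ++ W, ?_⟩
      funext q
      rw [Function.iterate_succ_apply, hW]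
      simp [DFA.evalFrom_of_append]
  constructor
  · intro hsf w hw
    refine ⟨?_, ?_, ?_⟩
    · intro q hq
      obtain ⟨u, hu⟩ := hmin.1 q
      obtain ⟨v, hv⟩ := hsub ⟨0, by omega⟩ (by
        intro h
        have := congrArg Fin.val h
        simp at this
        omega)
      have := hsf (u ++ w) v (by
        change M.evalFrom M.start v ∈ M.accept
        rw [hstart]; exact hv) (by
        change M.evalFrom M.start (u ++ w ++ v) ∈ M.accept
        rw [DFA.evalFrom_of_append, DFA.evalFrom_of_append, hu]
        change M.evalFrom q w = _ at hq
        rw [hq]; exact hv)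
      exact hw (List.append_eq_nil_iff.1 this).2
    · by_contra h
      obtain ⟨x, hx⟩ := hsub _ h
      apply hdead (w ++ x)
      rw [DFA.evalFrom_of_append]
      exact hx
    · intro j _
      obtain ⟨W, hW⟩ := hiter w j
      rw [hW]
      by_contra h
      push Not at h
      obtain ⟨h1, q, hq0, -, hq⟩ := h
      obtain ⟨x, hx⟩ := hsub _ h1
      obtain ⟨u, hu⟩ := hmin.1 q
      have := hsf u (W ++ x) (by
        change M.evalFrom M.start (W ++ x) ∈ M.accept
        rw [DFA.evalFrom_of_append, hstart]; exact hx) (by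
        change M.evalFrom M.start (u ++ (W ++ x)) ∈ M.accept
        rw [DFA.evalFrom_of_append, DFA.evalFrom_of_append, hu]
        change M.evalFrom (M.evalFrom _ W) x ∈ _ at hx
        rw [hq] at hx; exact hx)
      subst this
      rw [DFA.evalFrom_nil, hstart] at hu
      rw [← hu] at hq0
      simp at hq0
  · rintro ⟨f, -, huniq⟩ hB u v hv huv
    by_contra hu
    change M.evalFrom M.start v ∈ M.accept at hv
    change M.evalFrom M.start (u ++ v) ∈ M.accept at huv
    rw [DFA.evalFrom_of_append] at huv
    rw [hstart] at hv huv
    have heq := (huniq _ hv).trans (huniq _ huv).symm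
    have hne : M.evalFrom ⟨0, by omega⟩ u ≠ ⟨0, by omega⟩ := (hB u hu).1 ⟨0, by omega⟩
    by_cases hv0 : v = []
    · subst hv0
      exact hne heq.symm
    · rcases (hB v hv0).2.2 1 le_rfl with h | h
      · apply hdead []
        simp only [Function.iterate_one] at h
        rw [h] at hv
        exact hv
      · generalize hq : M.evalFrom ⟨0, by omega⟩ u = q at *
        refine h q ?_ ?_ heq
        · rcases Nat.eq_zero_or_pos q.val with h0 | h0
          · exact absurd (Fin.ext h0) hne
          · exact h0
        · by_contra h0
          have : q = ⟨n - 1, by omega⟩ := Fin.ext (by have := q.2; simp only; omega)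
          rw [this] at huv
          exact hdead v huv
end

section
/- For n ≥ 4, the semigroup of transformations of Q_n generated under composition by the set Msf(n) = { a, b, c_1, …, c_{n−2} }, where a = (0→n−1)(1,…,n−2), b = (0→n−1)(1,2), and c_p = (p→n−1)(0→p) for each 1 ≤ p ≤ n−2, is exactly Vsf(n). -/
/-- Transformation `a : (0→n−1)(1,…,n−2)`. -/
def aT (n : ℕ) (hn : 4 ≤ n) : Fin n → Fin n := fun q =>
  if q.val = 0 then ⟨n - 1, by omega⟩
  else if _h1 : q.val = n - 2 then ⟨1, by omega⟩
  else if _h2 : q.val = n - 1 then q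
  else ⟨q.val + 1, by have := q.isLt; omega⟩

/-- Transformation `b : (0→n−1)(1,2)`. -/
def bT (n : ℕ) (hn : 4 ≤ n) : Fin n → Fin n := fun q =>
  if q.val = 0 then ⟨n - 1, by omega⟩
  else if q.val = 1 then ⟨2, by omega⟩
  else if q.val = 2 then ⟨1, by omega⟩
  else q

/-- Transformation `c : (0→n−1)(n−2→1)`. -/
def cT (n : ℕ) (hn : 4 ≤ n) : Fin n → Fin n := fun q =>
  if q.val = 0 then ⟨n - 1, by omega⟩
  else if q.val = n - 2 then ⟨1, by omega⟩
  else q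

/-- Transformation `d : ({0,1}→n−1)`. -/
def dT (n : ℕ) (hn : 4 ≤ n) : Fin n → Fin n := fun q =>
  if q.val ≤ 1 then ⟨n - 1, by omega⟩ else q

/-- Transformation `e : (Q_n\{0}→n−1)(0→1)`. -/
def eT (n : ℕ) (hn : 4 ≤ n) : Fin n → Fin n := fun q =>
  if q.val = 0 then ⟨1, by omega⟩ else ⟨n - 1, by omega⟩

/-- Transformation `c_p : (p→n−1)(0→p)`. -/
def cV (n : ℕ) (hn : 4 ≤ n) (p : Fin n) : Fin n → Fin n := fun q =>
  if q = p then ⟨n - 1, by omega⟩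
  else if q.val = 0 then p
  else q

/-- The generating set `Msf(n) = {a, b, c_1, …, c_{n−2}}`. -/
def Msf (n : ℕ) (hn : 4 ≤ n) : Set (Fin n → Fin n) :=
  {aT n hn, bT n hn} ∪ {t | ∃ p : Fin n, 1 ≤ p.val ∧ p.val ≤ n - 2 ∧ t = cV n hn p}

theorem mem_Vsf_iff (n : ℕ) (hn : 0 < n) (t : Fin n → Fin n) :
    t ∈ Vsf n hn ↔ (∀ q, (t q).val ≠ 0) ∧ (∀ q : Fin n, q.val = n - 1 → (t q).val = n - 1) ∧
      ∀ p q, t p = t q → p = q ∨ (t p).val = n - 1 := by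
  constructor
  · rintro ⟨⟨h0, h1, -⟩, h2⟩
    refine ⟨fun q h => h0 q (Fin.ext h), fun q hq => ?_, fun p q hpq => ?_⟩
    · have : q = ⟨n - 1, by omega⟩ := Fin.ext hq
      rw [this, h1]
    · by_cases hne : p = q
      · exact Or.inl hne
      · rcases h2 p q hne with h | h
        · right; rw [h.1]
        · exact absurd hpq h
  · rintro ⟨h0, h1, h2⟩
    have key : ∀ j p q, t^[j] p = t^[j] q → p = q ∨ (t^[j] p).val = n - 1 := by
      intro j
      induction j with
      | zero => intro p q h; left; simpa using h
      | succ j ih =>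
        intro p q h
        rw [Function.iterate_succ_apply', Function.iterate_succ_apply'] at h
        rw [Function.iterate_succ_apply']
        rcases h2 _ _ h with h3 | h3
        · rcases ih p q h3 with h4 | h4
          · exact Or.inl h4
          · exact Or.inr (h1 _ h4)
        · exact Or.inr h3
    refine ⟨⟨fun q h => h0 q (by rw [h]), Fin.ext (h1 _ rfl), fun j _ => ?_⟩, fun p q hne => ?_⟩
    · by_cases h : t^[j] ⟨0, hn⟩ = ⟨n - 1, by omega⟩
      · exact Or.inl h
      · right
        intro q hq _ he
        rcases key j _ _ he with h3 | h3
        · rw [← h3] at hq; simp at hq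
        · exact h (Fin.ext h3)
    · by_cases h : t p = t q
      · left
        rcases h2 p q h with h3 | h3
        · exact absurd h3 hne
        · exact ⟨Fin.ext h3, h ▸ Fin.ext h3⟩
      · exact Or.inr h

theorem genSG_sub {β : Type} (G : Set (β → β)) : G ⊆ genSG G := by
  intro f hf T hT
  exact hT.1 hf

theorem genSG_comp {β : Type} (G : Set (β → β)) {f g : β → β} (hf : f ∈ genSG G)
    (hg : g ∈ genSG G) : g ∘ f ∈ genSG G := by
  intro T hT
  exact hT.2 f (hf T hT) g (hg T hT)

theorem aT_val (n : ℕ) (hn : 4 ≤ n) (q : Fin n) : (aT n hn q).val =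
    if q.val = 0 then n - 1 else if q.val = n - 2 then 1 else if q.val = n - 1 then n - 1
      else q.val + 1 := by
  unfold aT; split_ifs <;> simp_all

theorem bT_val (n : ℕ) (hn : 4 ≤ n) (q : Fin n) : (bT n hn q).val =
    if q.val = 0 then n - 1 else if q.val = 1 then 2 else if q.val = 2 then 1 else q.val := by
  unfold bT; split_ifs <;> simp_all

theorem cV_val (n : ℕ) (hn : 4 ≤ n) (p q : Fin n) : (cV n hn p q).val =
    if q.val = p.val then n - 1 else if q.val = 0 then p.val else q.val := by
  unfold cV; simp only [Fin.ext_iff]; split_ifs <;> simp_all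

/-- Permutation of the middle states extended to `Q_n`. -/
def permT (n : ℕ) (hn : 4 ≤ n) (σ : Equiv.Perm (Fin (n - 2))) : Fin n → Fin n := fun q =>
  if h : 1 ≤ q.val ∧ q.val ≤ n - 2 then
    ⟨(σ ⟨q.val - 1, by omega⟩).val + 1, by have := (σ ⟨q.val - 1, by omega⟩).isLt; omega⟩
  else ⟨n - 1, by omega⟩

theorem permT_mul (n : ℕ) (hn : 4 ≤ n) (σ τ : Equiv.Perm (Fin (n - 2))) :
    permT n hn (σ * τ) = permT n hn σ ∘ permT n hn τ := by
  funext q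
  apply Fin.ext
  by_cases h : 1 ≤ q.val ∧ q.val ≤ n - 2
  · have := (τ ⟨q.val - 1, by omega⟩).isLt
    have h3 : (τ ⟨q.val - 1, by omega⟩).val + 1 ≤ n - 2 := by omega
    simp [permT, h, h3]
  · have h3 : ¬ (n - 1 ≤ n - 2) := by omega
    simp [permT, h, h3]

theorem permT_rot (n : ℕ) (hn : 4 ≤ n) : permT n hn (finRotate (n - 2)) = aT n hn := by
  obtain ⟨m, rfl⟩ : ∃ m, n = m + 3 := ⟨n - 3, by omega⟩
  funext q
  apply Fin.ext
  rw [aT_val]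
  have hq := q.isLt
  by_cases h : 1 ≤ q.val ∧ q.val ≤ m + 3 - 2
  · have := coe_finRotate (n := m) ⟨q.val - 1, by omega⟩
    simp only [permT, h, and_self, dite_true]
    erw [this]
    simp only [Fin.ext_iff, Fin.val_last]
    split_ifs <;> omega
  · simp only [permT, h, dite_false]
    split_ifs <;> omega

theorem permT_swap (n : ℕ) (hn : 4 ≤ n) :
    permT n hn (Equiv.swap ⟨0, by omega⟩ ⟨1, by omega⟩) = bT n hn := by
  funext q
  apply Fin.ext
  rw [bT_val]
  have hq := q.isLt
  by_cases h : 1 ≤ q.val ∧ q.val ≤ n - 2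
  · simp only [permT, h, and_self, dite_true, Equiv.swap_apply_def, Fin.ext_iff]
    split_ifs <;> simp <;> omega
  · simp only [permT, h, dite_false]
    split_ifs <;> omega

theorem permT_mem (n : ℕ) (hn : 4 ≤ n) (σ : Equiv.Perm (Fin (n - 2))) :
    permT n hn σ ∈ genSG (Msf n hn) := by
  have ha : permT n hn (finRotate (n - 2)) ∈ genSG (Msf n hn) := by
    rw [permT_rot]; exact genSG_sub _ (Or.inl (Or.inl rfl))
  have hb : permT n hn (Equiv.swap ⟨0, by omega⟩ ⟨1, by omega⟩) ∈ genSG (Msf n hn) := by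
    rw [permT_swap]; exact genSG_sub _ (Or.inl (Or.inr rfl))
  let S : Submonoid (Equiv.Perm (Fin (n - 2))) :=
    { carrier := {σ | permT n hn σ ∈ genSG (Msf n hn)}
      mul_mem' := by
        intro σ τ h1 h2
        simp only [Set.mem_setOf_eq] at *
        rw [permT_mul]
        exact genSG_comp _ h2 h1
      one_mem' := by
        have := genSG_comp _ hb hb
        rw [← permT_mul, Equiv.swap_mul_self] at this
        exact this }
  have hr : finRotate (n - 2) ⟨0, by omega⟩ = ⟨1, by omega⟩ := by
    obtain ⟨m, rfl⟩ : ∃ m, n = m + 4 := ⟨n - 4, by omega⟩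
    exact finRotate_apply_zero (n := m + 1)
  have hc := Equiv.Perm.closure_cycle_adjacent_swap (isCycle_finRotate_of_le (n := n - 2) (by omega))
    (support_finRotate_of_le (by omega)) ⟨0, by omega⟩
  rw [hr] at hc
  have hle : Submonoid.closure ({finRotate (n - 2), Equiv.swap ⟨0, by omega⟩ ⟨1, by omega⟩} :
      Set (Equiv.Perm (Fin (n - 2)))) ≤ S := by
    rw [Submonoid.closure_le]
    rintro x (rfl | rfl)
    · exact ha
    · exact hb
  rw [← Subgroup.closure_toSubmonoid_of_finite, hc] at hle
  exact hle (Subgroup.mem_top σ)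

theorem cV_mem (n : ℕ) (hn : 4 ≤ n) (p : Fin n) (h1 : 1 ≤ p.val) (h2 : p.val ≤ n - 2) :
    cV n hn p ∈ genSG (Msf n hn) :=
  genSG_sub _ (Or.inr ⟨p, h1, h2, rfl⟩)

theorem mem_of_zero (n : ℕ) (hn : 4 ≤ n) (k : ℕ) : ∀ (t : Fin n → Fin n),
    (∀ q, (t q).val ≠ 0) → (∀ q : Fin n, q.val = n - 1 → (t q).val = n - 1) →
    (∀ p q, t p = t q → p = q ∨ (t p).val = n - 1) →
    (∀ q : Fin n, q.val = 0 → (t q).val = n - 1) →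
    (Finset.univ.filter (fun q : Fin n => (t q).val = n - 1)).card = k →
    t ∈ genSG (Msf n hn) := by
  induction k with
  | zero =>
    intro t h0 h1 h2 h3 hk
    exfalso
    rw [Finset.card_eq_zero] at hk
    have : (⟨0, by omega⟩ : Fin n) ∈ Finset.univ.filter (fun q : Fin n => (t q).val = n - 1) := by
      simp [h3]
    rw [hk] at this
    simp at this
  | succ k ih =>
    intro t h0 h1 h2 h3 hk
    by_cases hp : ∃ p : Fin n, 1 ≤ p.val ∧ p.val ≤ n - 2 ∧ (t p).val = n - 1
    · obtain ⟨p, hp1, hp2, hp3⟩ := hp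
      obtain ⟨r, hr1, hr2, hr3⟩ : ∃ r : Fin n, 1 ≤ r.val ∧ r.val ≤ n - 2 ∧ ∀ q, t q ≠ r := by
        by_contra! hcon
        let M := Finset.univ.filter (fun q : Fin n => 1 ≤ q.val ∧ q.val ≤ n - 2)
        have hsub : M ⊆ (M.erase p).image t := by
          intro r hr
          simp only [M, Finset.mem_filter, Finset.mem_univ, true_and] at hr
          obtain ⟨q, hq⟩ := hcon r hr.1 hr.2
          simp only [M, Finset.mem_image, Finset.mem_erase, Finset.mem_filter, Finset.mem_univ,
            true_and]
          have hlt := q.isLt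
          have e : (t q).val = r.val := by rw [hq]
          refine ⟨q, ⟨?_, ?_, ?_⟩, hq⟩
          · rintro rfl; omega
          · by_contra h; have := h3 q (by omega); omega
          · by_contra h; have := h1 q (by omega); omega
        have hc := (Finset.card_le_card hsub).trans Finset.card_image_le
        have hpM : p ∈ M := by simp [M, hp1, hp2]
        have := Finset.card_erase_lt_of_mem hpM
        omega
      have ht : t = cV n hn r ∘ Function.update t p r := by
        funext q
        apply Fin.ext
        rw [Function.comp, cV_val]
        by_cases hq : q = p
        · subst hq; simp [hp3]
        · rw [Function.update_of_ne hq]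
          have := h0 q
          have h5 : (t q).val ≠ r.val := fun h => hr3 q (Fin.ext h)
          simp [this, h5]
      rw [ht]
      refine genSG_comp _ (ih _ ?_ ?_ ?_ ?_ ?_) (cV_mem n hn r hr1 hr2)
      · intro q
        by_cases hq : q = p
        · subst hq; simp; omega
        · rw [Function.update_of_ne hq]; exact h0 q
      · intro q hq'
        rw [Function.update_of_ne (by rintro rfl; omega)]; exact h1 q hq'
      · intro q q' h
        by_cases hq : q = p <;> by_cases hq' : q' = p
        · left; rw [hq, hq']
        · subst hq
          rw [Function.update_self, Function.update_of_ne hq'] at h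
          exact absurd h.symm (hr3 _)
        · subst hq'
          rw [Function.update_self, Function.update_of_ne hq] at h
          exact absurd h (hr3 _)
        · rw [Function.update_of_ne hq, Function.update_of_ne hq'] at h
          rw [Function.update_of_ne hq]
          exact h2 _ _ h
      · intro q hq'
        rw [Function.update_of_ne (by rintro rfl; omega)]; exact h3 q hq'
      · have : Finset.univ.filter (fun q : Fin n => (Function.update t p r q).val = n - 1) =
            (Finset.univ.filter (fun q : Fin n => (t q).val = n - 1)).erase p := by
          ext q
          by_cases hq : q = p
          · subst hq; simp; omega
          · simp [Function.update_of_ne hq, hq]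
        rw [this, Finset.card_erase_of_mem (by simp [hp3]), hk]
        simp
    · push Not at hp
      have hb : ∀ i : Fin (n - 2), 1 ≤ (t ⟨i.val + 1, by omega⟩).val ∧
          (t ⟨i.val + 1, by omega⟩).val ≤ n - 2 := by
        intro i
        have a1 := h0 ⟨i.val + 1, by omega⟩
        have a2 := hp ⟨i.val + 1, by omega⟩ (by simp) (by simp; try omega)
        have a3 := (t ⟨i.val + 1, by omega⟩).isLt
        omega
      let f : Fin (n - 2) → Fin (n - 2) := fun i =>
        ⟨(t ⟨i.val + 1, by omega⟩).val - 1, by have := hb i; omega⟩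
      have hf : Function.Injective f := by
        intro i j hij
        simp only [f, Fin.mk.injEq] at hij
        have b1 := hb i
        have b2 := hb j
        rcases h2 ⟨i.val + 1, by omega⟩ ⟨j.val + 1, by omega⟩ (Fin.ext (by omega)) with h | h
        · simp only [Fin.mk.injEq] at h; exact Fin.ext (by omega)
        · omega
      have : t = permT n hn (Equiv.ofBijective f (Finite.injective_iff_bijective.mp hf)) := by
        funext q
        apply Fin.ext
        have hlt := q.isLt
        by_cases h : 1 ≤ q.val ∧ q.val ≤ n - 2
        · have e : (⟨q.val - 1 + 1, by omega⟩ : Fin n) = q := Fin.ext (by simp; omega)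
          simp only [permT, h, and_self, dite_true, Equiv.ofBijective_apply, f, e]
          have := h0 q
          omega
        · simp only [permT, h, dite_false]
          by_cases hq : q.val = 0
          · exact h3 q hq
          · exact h1 q (by omega)
      rw [this]
      exact permT_mem n hn _

/-- For `n ≥ 4`, the semigroup generated by `Msf(n)` is exactly `Vsf(n)`. -/
theorem stmt3 (n : ℕ) (hn : 4 ≤ n) : genSG (Msf n hn) = Vsf n (by omega) := by
  apply Set.Subset.antisymm
  · intro t ht
    refine ht (Vsf n (by omega)) ⟨?_, ?_⟩
    · rintro f ((rfl | rfl) | ⟨p, hp1, hp2, rfl⟩)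
      all_goals
        rw [mem_Vsf_iff]
        refine ⟨fun q => ?_, fun q hq => ?_, fun p q hpq => ?_⟩
      · have := q.isLt; rw [aT_val]; split_ifs <;> omega
      · rw [aT_val]; split_ifs <;> omega
      · have hpq := congrArg Fin.val hpq
        have := p.isLt
        have := q.isLt
        rw [Fin.ext_iff]
        simp only [aT_val] at hpq ⊢; split_ifs at hpq ⊢ <;> omega
      · have := q.isLt; rw [bT_val]; split_ifs <;> omega
      · rw [bT_val]; split_ifs <;> omega
      · have hpq := congrArg Fin.val hpq
        have := p.isLt
        have := q.isLt
        rw [Fin.ext_iff]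
        simp only [bT_val] at hpq ⊢; split_ifs at hpq ⊢ <;> omega
      · have := q.isLt; rw [cV_val]; split_ifs <;> omega
      · rw [cV_val]; split_ifs <;> omega
      · have hpq := congrArg Fin.val hpq
        have := p.isLt
        have := q.isLt
        rw [Fin.ext_iff]
        simp only [cV_val] at hpq ⊢; split_ifs at hpq ⊢ <;> omega
    · intro f hf g hg
      rw [mem_Vsf_iff] at *
      refine ⟨fun q => hg.1 _, fun q hq => hg.2.1 _ (hf.2.1 q hq), fun p q hpq => ?_⟩
      rcases hg.2.2 _ _ hpq with h | h
      · rcases hf.2.2 _ _ h with h' | h'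
        · exact Or.inl h'
        · exact Or.inr (hg.2.1 _ h')
      · exact Or.inr h
  · intro t ht
    rw [mem_Vsf_iff] at ht
    obtain ⟨h0, h1, h2⟩ := ht
    let z : Fin n := ⟨0, by omega⟩
    have hz : ∀ q : Fin n, q.val = 0 → q = z := fun q hq => Fin.ext hq
    by_cases h3 : (t z).val = n - 1
    · exact mem_of_zero n hn _ t h0 h1 h2 (fun q hq => by rw [hz q hq]; exact h3) rfl
    · obtain ⟨p, hp1, hp2, hp3⟩ : ∃ p : Fin n, 1 ≤ p.val ∧ p.val ≤ n - 2 ∧ (t p).val = n - 1 := by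
        by_contra! hcon
        have hne : ∀ q : Fin n, q.val ≤ n - 2 → (t q).val ≠ n - 1 := by
          intro q hq
          by_cases hq0 : q.val = 0
          · rw [hz q hq0]; exact h3
          · exact hcon q (by omega) hq
        let f : Fin (n - 1) → Fin (n - 2) := fun i =>
          ⟨(t ⟨i.val, by omega⟩).val - 1, by
            have := hne ⟨i.val, by omega⟩ (by simp; omega)
            have := (t ⟨i.val, by omega⟩).isLt
            omega⟩
        have hf : Function.Injective f := by
          intro i j hij
          simp only [f, Fin.mk.injEq] at hij
          have b1 := h0 ⟨i.val, by omega⟩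
          have b2 := h0 ⟨j.val, by omega⟩
          rcases h2 ⟨i.val, by omega⟩ ⟨j.val, by omega⟩ (Fin.ext (by omega)) with h | h
          · simp only [Fin.mk.injEq] at h; exact Fin.ext h
          · exact absurd h (hne _ (by simp; omega))
        have := Fintype.card_le_of_injective f hf
        simp at this
        omega
      have hpz : p ≠ z := by intro h; rw [h] at hp1; simp [z] at hp1
      let s : Fin n → Fin n := fun q => if q = p then t z else if q = z then ⟨n - 1, by omega⟩ else t q
      have hsp : s p = t z := by simp [s]
      have hsz : s z = ⟨n - 1, by omega⟩ := by simp [s, hpz.symm]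
      have hso : ∀ q, q ≠ p → q ≠ z → s q = t q := fun q a b => by simp [s, a, b]
      have ht : t = s ∘ cV n hn p := by
        funext q
        by_cases hq : q = p
        · have e : cV n hn p q = ⟨n - 1, by omega⟩ := by simp [cV, hq]
          rw [Function.comp, e, hso _ (by intro h; rw [← h] at hp2; simp at hp2; omega)
            (by simp [z]; omega), hq]
          apply Fin.ext
          rw [hp3, h1 _ rfl]
        · by_cases hq' : q = z
          · have e : cV n hn p q = p := by subst hq'; simp [cV, hpz.symm, z]
            rw [Function.comp, e, hsp, hq']
          · have e : cV n hn p q = q := by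
              have : q.val ≠ 0 := fun h => hq' (hz q h)
              unfold cV; rw [if_neg hq, if_neg this]
            rw [Function.comp, e, hso _ hq hq']
      rw [ht]
      refine genSG_comp _ (cV_mem n hn p hp1 hp2) (mem_of_zero n hn _ s ?_ ?_ ?_ ?_ rfl)
      · intro q
        simp only [s]; split_ifs
        · exact h0 _
        · simp; omega
        · exact h0 _
      · intro q hq
        rw [hso _ (by rintro rfl; omega) (by rintro rfl; simp [z] at hq; omega)]
        exact h1 q hq
      · intro q q' h
        by_cases a1 : q = p <;> by_cases a2 : q' = p
        · left; rw [a1, a2]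
        · by_cases b2 : q' = z
          · right; rw [h, b2, hsz]
          · rw [a1, hsp, hso _ a2 b2] at h
            rw [a1, hsp]
            rcases h2 _ _ h with h | h
            · exact absurd h.symm b2
            · exact Or.inr h
        · by_cases b1 : q = z
          · right; rw [b1, hsz]
          · rw [a2, hsp, hso _ a1 b1] at h
            rw [hso _ a1 b1]
            rcases h2 _ _ h with h | h
            · exact absurd h b1
            · exact Or.inr h
        · by_cases b1 : q = z
          · right; rw [b1, hsz]
          · by_cases b2 : q' = z
            · right; rw [h, b2, hsz]
            · rw [hso _ a1 b1, hso _ a2 b2] at h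
              rw [hso _ a1 b1]
              exact h2 _ _ h
      · intro q hq
        rw [hz q hq, hsz]
end

section
/- For n ≥ 5, the semigroup Vsf(n) cannot be generated by fewer than n transformations: every set G of transformations of Q_n whose generated semigroup under composition equals Vsf(n) satisfies |G| ≥ n. -/
/-- simplified description -/
def PV {n : ℕ} (Z L : Fin n) (t : Fin n → Fin n) : Prop :=
  (∀ q, t q ≠ Z) ∧ t L = L ∧ ∀ p q, t p = t q → t p ≠ L → p = q

theorem PV.iter {n : ℕ} {Z L : Fin n} {t : Fin n → Fin n} (h : PV Z L t) (j : ℕ) :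
    t^[j] L = L ∧ ∀ p q, t^[j] p = t^[j] q → t^[j] p ≠ L → p = q := by
  induction j with
  | zero => exact ⟨rfl, fun p q h _ => h⟩
  | succ k ih =>
    refine ⟨by rw [Function.iterate_succ_apply, h.2.1, ih.1], fun p q hpq hp => ?_⟩
    rw [Function.iterate_succ_apply] at hpq hp
    rw [Function.iterate_succ_apply] at hpq
    refine h.2.2 p q (ih.2 _ _ hpq hp) ?_
    intro hL
    rw [hL] at hp
    exact hp ih.1

theorem mem_Vsf_iff_s5 {n : ℕ} (hn : 0 < n) (t : Fin n → Fin n) :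
    t ∈ Vsf n hn ↔ PV ⟨0, hn⟩ ⟨n - 1, by omega⟩ t := by
  constructor
  · rintro ⟨⟨h0, hL, _⟩, hi⟩
    refine ⟨h0, hL, fun p q hpq hp => ?_⟩
    by_contra hne
    rcases hi p q hne with h | h
    · exact hp h.1
    · exact h hpq
  · intro h
    refine ⟨⟨h.1, h.2.1, fun j _ => ?_⟩, fun p q hne => ?_⟩
    · by_contra hc
      push Not at hc
      obtain ⟨h1, q, hq, _, h3⟩ := hc
      have := (h.iter j).2 _ _ h3 h1
      rw [← this] at hq
      exact absurd hq (lt_irrefl _)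
    · by_cases e : t p = t q
      · left
        have : t p = ⟨n - 1, by omega⟩ := by
          by_contra hp
          exact hne (h.2.2 p q e hp)
        exact ⟨this, e ▸ this⟩
      · exact Or.inr e

theorem PV.comp {n : ℕ} {Z L : Fin n} {f g : Fin n → Fin n} (hf : PV Z L f) (hg : PV Z L g) :
    PV Z L (g ∘ f) := by
  refine ⟨fun q => hg.1 _, by simp [hf.2.1, hg.2.1], fun p q h hp => ?_⟩
  refine hf.2.2 p q (hg.2.2 _ _ h hp) ?_
  intro e
  apply hp
  simp [e, hg.2.1]

def CK {n : ℕ} (L q : Fin n) (t : Fin n → Fin n) : Prop := ∀ x, t x = L ↔ x = q ∨ x = L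

theorem PV.exists_ker {n : ℕ} {Z L : Fin n} {t : Fin n → Fin n} (h : PV Z L t) :
    ∃ x, x ≠ L ∧ t x = L := by
  by_contra hc
  push Not at hc
  have inj : Function.Injective t := by
    intro p q e
    by_cases hp : t p = L
    · have h1 : p = L := by by_contra hh; exact hc p hh hp
      have h2 : q = L := by by_contra hh; exact hc q hh (e ▸ hp)
      rw [h1, h2]
    · exact h.2.2 p q e hp
  obtain ⟨x, hx⟩ := (Finite.injective_iff_surjective.1 inj) Z
  exact h.1 x hx

theorem CK.surj {n : ℕ} {Z L q : Fin n} {f : Fin n → Fin n} (h : PV Z L f)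
    (hf : CK L q f) (hqL : q ≠ L) (y : Fin n) (hy : y ≠ Z) : ∃ x, f x = y := by
  have inj : Function.Injective (Function.update f q Z) := by
    intro a b e
    by_cases ha : a = q <;> by_cases hb : b = q
    · rw [ha, hb]
    · subst ha
      simp [Function.update_of_ne hb] at e
      exact absurd e.symm (h.1 b)
    · subst hb
      simp [Function.update_of_ne ha] at e
      exact absurd e (h.1 a)
    · rw [Function.update_of_ne ha, Function.update_of_ne hb] at e
      by_cases hl : f a = L
      · have h1 := (hf a).1 hl
        have h2 := (hf b).1 (e ▸ hl)
        simp [ha] at h1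
        simp [hb] at h2
        rw [h1, h2]
      · exact h.2.2 a b e hl
  obtain ⟨x, hx⟩ := (Finite.injective_iff_surjective.1 inj) y
  by_cases hq : x = q
  · subst hq
    simp at hx
    exact absurd hx.symm hy
  · rw [Function.update_of_ne hq] at hx
    exact ⟨x, hx⟩

theorem CK.fact {n : ℕ} {Z L q : Fin n} {f g : Fin n → Fin n} (hf : PV Z L f) (hg : PV Z L g)
    (hqL : q ≠ L) (h : CK L q (g ∘ f)) : CK L q f ∧ CK L Z g := by
  have h1 : CK L q f := by
    have sub : ∀ x, f x = L → x = q ∨ x = L := fun x hx => (h x).1 (by simp [hx, hg.2.1])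
    obtain ⟨x, hx, hfx⟩ := hf.exists_ker
    have hxq : x = q := (sub x hfx).resolve_right hx
    intro y
    refine ⟨sub y, ?_⟩
    rintro (e | e)
    · rw [e, ← hxq, hfx]
    · rw [e, hf.2.1]
  refine ⟨h1, ?_⟩
  have sub : ∀ y, g y = L → y = Z ∨ y = L := by
    intro y hy
    by_cases hyz : y = Z
    · exact Or.inl hyz
    · obtain ⟨x, hx⟩ := CK.surj hf h1 hqL y hyz
      right
      rw [← hx]
      exact (h1 x).2 ((h x).1 (by simp [hx, hy]))
  obtain ⟨x, hx, hgx⟩ := hg.exists_ker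
  have hxq : x = Z := (sub x hgx).resolve_right hx
  intro y
  refine ⟨sub y, ?_⟩
  rintro (e | e)
  · rw [e, ← hxq, hgx]
  · rw [e, hg.2.1]

theorem genSG_ind {n : ℕ} {Z L : Fin n} {G : Set (Fin n → Fin n)}
    (hG : ∀ t, t ∈ genSG G ↔ PV Z L t) (P : (Fin n → Fin n) → Prop)
    (hb : ∀ t ∈ G, PV Z L t → P t)
    (hs : ∀ f g, PV Z L f → PV Z L g → P f → P g → P (g ∘ f)) (t : Fin n → Fin n)
    (ht : PV Z L t) : P t := by
  have hsub : ∀ t ∈ G, PV Z L t := by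
    intro t ht
    rw [← hG]
    intro T hT
    exact hT.1 ht
  have := (hG t).2 ht {t | PV Z L t ∧ P t}
    ⟨fun t ht => ⟨hsub t ht, hb t ht (hsub t ht)⟩,
      fun f hf g hg => ⟨hf.1.comp hg.1, hs f g hf.1 hg.1 hf.2 hg.2⟩⟩
  exact this.2

theorem PV.of_perm {n : ℕ} {Z L : Fin n} (hZL : Z ≠ L) (σ : Equiv.Perm (Fin n))
    (hZ : σ Z = Z) (hL : σ L = L) :
    PV Z L (fun x => if x = Z then L else σ x) ∧ CK L Z (fun x => if x = Z then L else σ x) := by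
  have e1 : ∀ x, σ x = L ↔ x = L := fun x =>
    ⟨fun h => σ.injective (h.trans hL.symm), fun h => by rw [h, hL]⟩
  have e2 : ∀ x, σ x = Z ↔ x = Z := fun x =>
    ⟨fun h => σ.injective (h.trans hZ.symm), fun h => by rw [h, hZ]⟩
  have e3 : ∀ x y, σ x = σ y → x = y := fun x y h => σ.injective h
  refine ⟨⟨?_, ?_, ?_⟩, ?_⟩
  · intro q; grind
  · grind
  · intro p q; grind
  · intro x; grind

theorem exists_CK {n : ℕ} {Z L : Fin n} (hZL : Z ≠ L) (q : Fin n) (hq : q ≠ L) :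
    ∃ t, PV Z L t ∧ CK L q t := by
  refine ⟨fun x => if x = q then L else if x = Z then q else x, ⟨?_, ?_, ?_⟩, ?_⟩
  · intro q; grind
  · grind
  · intro p q; grind
  · intro x; grind

/-- For `n ≥ 5`, the semigroup `Vsf(n)` cannot be generated by fewer than `n`
transformations. -/
theorem stmt5 (n : ℕ) (hn : 5 ≤ n) (G : Set (Fin n → Fin n))
    (hG : genSG G = Vsf n (by omega)) : n ≤ G.ncard := by
  classical
  have h0 : 0 < n := by omega
  obtain ⟨Z, hZ⟩ : ∃ Z : Fin n, Z = ⟨0, h0⟩ := ⟨_, rfl⟩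
  obtain ⟨L, hL⟩ : ∃ L : Fin n, L = ⟨n - 1, by omega⟩ := ⟨_, rfl⟩
  have hZL : Z ≠ L := by rw [hZ, hL]; simp [Fin.ext_iff]; omega
  have hG' : ∀ t, t ∈ genSG G ↔ PV Z L t := by
    intro t; rw [hG, mem_Vsf_iff_s5, hZ, hL]
  have hC : ∀ q, ∃ g, q ≠ L → g ∈ G ∧ CK L q g := by
    intro q
    by_cases hq : q = L
    · exact ⟨id, fun h => absurd hq h⟩
    obtain ⟨t, ht, htc⟩ := exists_CK hZL q hq
    have := genSG_ind hG' (fun t => CK L q t → ∃ g, q ≠ L → g ∈ G ∧ CK L q g)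
      (fun t ht _ hc => ⟨t, fun _ => ⟨ht, hc⟩⟩)
      (fun f g hf hg pf _ hc => pf (CK.fact hf hg hq hc).1) t ht
    exact this htc
  choose γ hγ using hC
  have hB : ∃ b ∈ G, CK L Z b ∧ b ≠ γ Z := by
    by_contra hc
    push Not at hc
    have aG := hγ Z hZL
    have step1 : ∀ t, PV Z L t → CK L Z t → t ∘ γ Z = γ Z ∘ t := by
      refine genSG_ind hG' _ (fun t ht _ hct => by rw [hc t ht hct]) ?_
      intro f g hf hg pf pg hh
      obtain ⟨h1, h2⟩ := CK.fact hf hg hZL hh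
      rw [Function.comp_assoc, pf h1, ← Function.comp_assoc, pg h2, Function.comp_assoc]
    have step2 : ∀ t, PV Z L t → CK L Z t → ∀ s, PV Z L s → CK L Z s → s ∘ t = t ∘ s := by
      refine genSG_ind hG' _ (fun t ht _ hct s hs hsc => by rw [hc t ht hct, step1 s hs hsc]) ?_
      intro f g hf hg pf pg hh s hs hsc
      obtain ⟨h1, h2⟩ := CK.fact hf hg hZL hh
      rw [← Function.comp_assoc, pg h2 s hs hsc, Function.comp_assoc, pf h1 s hs hsc,
        Function.comp_assoc]
    obtain ⟨x1, hx1⟩ : ∃ x : Fin n, x = ⟨1, by omega⟩ := ⟨_, rfl⟩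
    obtain ⟨x2, hx2⟩ : ∃ x : Fin n, x = ⟨2, by omega⟩ := ⟨_, rfl⟩
    obtain ⟨x3, hx3⟩ : ∃ x : Fin n, x = ⟨3, by omega⟩ := ⟨_, rfl⟩
    have v0 : Z.val = 0 := by rw [hZ]
    have v1 : x1.val = 1 := by rw [hx1]
    have v2 : x2.val = 2 := by rw [hx2]
    have v3 : x3.val = 3 := by rw [hx3]
    have vL : L.val = n - 1 := by rw [hL]
    have ne : ∀ a b : Fin n, a.val ≠ b.val → a ≠ b := fun a b h e => h (by rw [e])
    have n01 := ne Z x1 (by omega)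
    have n02 := ne Z x2 (by omega)
    have n03 := ne Z x3 (by omega)
    have n12 := ne x1 x2 (by omega)
    have n13 := ne x1 x3 (by omega)
    have n23 := ne x2 x3 (by omega)
    have nL1 := ne L x1 (by omega)
    have nL2 := ne L x2 (by omega)
    have nL3 := ne L x3 (by omega)
    have A := PV.of_perm hZL (Equiv.swap x1 x2) (Equiv.swap_apply_of_ne_of_ne n01 n02)
      (Equiv.swap_apply_of_ne_of_ne nL1 nL2)
    have B := PV.of_perm hZL (Equiv.swap x2 x3) (Equiv.swap_apply_of_ne_of_ne n02 n03)
      (Equiv.swap_apply_of_ne_of_ne nL2 nL3)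
    have := congrFun (step2 _ A.1 A.2 _ B.1 B.2) x1
    simp only [Function.comp, Equiv.swap_apply_def] at this
    grind
  obtain ⟨b, hbG, hbC, hbne⟩ := hB
  have key : ∀ p q g, p ≠ L → q ≠ L → CK L p g → CK L q g → p = q := by
    intro p q g hp hq h1 h2
    exact ((h2 p).1 ((h1 p).2 (Or.inl rfl))).resolve_right hp
  let F : Fin n → (Fin n → Fin n) := fun q => if q = L then b else γ q
  have Finj : Function.Injective F := by
    intro p q e
    by_cases hp : p = L <;> by_cases hq : q = L
    · rw [hp, hq]
    · simp only [F, hp, hq, if_true, if_false] at e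
      exfalso
      have : q = Z := key q Z b hq hZL (e ▸ (hγ q hq).2) hbC
      rw [this] at e
      exact hbne e
    · simp only [F, hp, hq, if_true, if_false] at e
      exfalso
      have : p = Z := key p Z b hp hZL (e ▸ (hγ p hp).2) hbC
      rw [this] at e
      exact hbne e.symm
    · simp only [F, hp, hq, if_false] at e
      exact key p q (γ p) hp hq (hγ p hp).2 (e ▸ (hγ q hq).2)
  have hsub : Set.range F ⊆ G := by
    rintro _ ⟨q, rfl⟩
    by_cases hq : q = L
    · simpa only [F, hq, if_true] using hbG
    · simpa only [F, hq, if_false] using (hγ q hq).1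
  have h1 := Set.ncard_le_ncard hsub (Set.toFinite G)
  have h2 : (Set.range F).ncard = n := by
    rw [← Set.image_univ, Set.ncard_image_of_injective _ Finj, Set.ncard_univ, Nat.card_fin]
  omega
end

section
/- For n ≥ 4: (i) Wsf(n) is contained in Bsf(n) and is closed under composition (it is a semigroup); (ii) its cardinality is |Wsf(n)| = (n−1)^{n−2} + (n−2); (iii) Wsf(n) equals the semigroup generated under composition by the transformations a = (0→n−1)(1,…,n−2), b = (0→n−1)(1,2), c = (0→n−1)(n−2→1), d = ({0,1}→n−1), and e = (Q_n\{0}→n−1)(0→1). -/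
def EP (k : ℕ) (σ : Equiv.Perm (Fin (k+2))) : Fin (k+4) → Fin (k+4) := fun q =>
  if h : 1 ≤ q.val ∧ q.val ≤ k+2 then
    ⟨(σ ⟨q.val - 1, by omega⟩).val + 1, by have := (σ ⟨q.val - 1, by omega⟩).isLt; omega⟩
  else ⟨k+3, by omega⟩

lemma EP_mid (k : ℕ) (σ : Equiv.Perm (Fin (k+2))) (i : Fin (k+2)) (h : i.val + 1 < k + 4) :
    EP k σ ⟨i.val + 1, h⟩ = ⟨(σ i).val + 1, by omega⟩ := by
  have : i.val + 1 ≤ k + 2 := by omega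
  simp [EP, this]

lemma EP_zero (k : ℕ) (σ : Equiv.Perm (Fin (k+2))) (h : 0 < k + 4) :
    EP k σ ⟨0, h⟩ = ⟨k+3, by omega⟩ := by simp [EP]

lemma EP_last (k : ℕ) (σ : Equiv.Perm (Fin (k+2))) (h : k + 3 < k + 4) :
    EP k σ ⟨k+3, h⟩ = ⟨k+3, by omega⟩ := by simp [EP]

lemma fin_cases3 (k : ℕ) (q : Fin (k+4)) : q = ⟨0, by omega⟩ ∨ q = ⟨k+3, by omega⟩ ∨
    ∃ i : Fin (k+2), q = ⟨i.val + 1, by omega⟩ := by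
  by_cases h0 : q.val = 0
  · left; exact Fin.ext h0
  by_cases h1 : q.val = k+3
  · right; left; exact Fin.ext h1
  · right; right
    exact ⟨⟨q.val - 1, by omega⟩, Fin.ext (by simp; omega)⟩

lemma EP_comp (k : ℕ) (σ τ : Equiv.Perm (Fin (k+2))) : EP k σ ∘ EP k τ = EP k (σ * τ) := by
  funext q
  rcases fin_cases3 k q with rfl | rfl | ⟨i, rfl⟩
  · simp only [Function.comp, EP_zero, EP_last]
  · simp only [Function.comp, EP_last]
  · simp only [Function.comp, EP_mid, Equiv.Perm.mul_apply]

lemma EP_inv (k : ℕ) (σ : Equiv.Perm (Fin (k+2))) (x : Fin (k+4)) (hx : x.val ≠ 0) :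
    EP k σ⁻¹ (EP k σ x) = x := by
  rcases fin_cases3 k x with rfl | rfl | ⟨i, rfl⟩
  · simp at hx
  · simp only [EP_last]
  · simp [EP_mid]

lemma EP_ne (k : ℕ) (σ : Equiv.Perm (Fin (k+2))) (x : Fin (k+4)) : (EP k σ x).val ≠ 0 := by
  rcases fin_cases3 k x with rfl | rfl | ⟨i, rfl⟩
  · rw [EP_zero]; simp
  · simp [EP_last]
  · simp [EP_mid]

lemma EP_rot (k : ℕ) (hn : 4 ≤ k + 4) : EP k (finRotate (k+2)) = aT (k+4) hn := by
  funext q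
  rcases fin_cases3 k q with rfl | rfl | ⟨i, rfl⟩
  · rw [EP_zero]; simp [aT]
  · simp [EP_last, aT]
  · rw [EP_mid]
    have := coe_finRotate (n := k+1) i
    have hi := i.isLt
    apply Fin.ext
    simp only [aT, Fin.ext_iff, Fin.val_last] at *
    rw [this]
    grind

lemma EP_swap (k : ℕ) (hn : 4 ≤ k + 4) : EP k (Equiv.swap 0 1) = bT (k+4) hn := by
  funext q
  rcases fin_cases3 k q with rfl | rfl | ⟨i, rfl⟩
  · rw [EP_zero]; simp [bT]
  · simp [EP_last, bT]
  · rw [EP_mid]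
    have hi := i.isLt
    apply Fin.ext
    simp only [bT, Equiv.swap_apply_def, Fin.ext_iff, Fin.val_zero, Fin.val_one]
    have e0 : (0 : Fin (k+2)).val = 0 := rfl
    have e1 : (1 : Fin (k+2)).val = 1 := rfl
    grind

lemma EP_mem (k : ℕ) (hn : 4 ≤ k + 4) (S : Set (Fin (k+4) → Fin (k+4)))
    (hS : ∀ f ∈ S, ∀ g ∈ S, g ∘ f ∈ S) (ha : aT (k+4) hn ∈ S) (hb : bT (k+4) hn ∈ S)
    (σ : Equiv.Perm (Fin (k+2))) : EP k σ ∈ S := by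
  let M : Submonoid (Equiv.Perm (Fin (k+2))) :=
    { carrier := {σ | EP k σ ∈ S}
      mul_mem' := by
        intro x y hx hy
        have := hS _ hy _ hx
        rwa [EP_comp] at this
      one_mem' := by
        have := hS _ hb _ hb
        rw [← EP_swap, EP_comp] at this
        simpa using this }
  have h1 := Equiv.Perm.closure_cycle_adjacent_swap (isCycle_finRotate (n := k))
    support_finRotate 0
  have h2 : Submonoid.closure {finRotate (k+2), Equiv.swap 0 (finRotate (k+2) 0)} ≤ M := by
    rw [Submonoid.closure_le]
    rintro x (rfl | rfl)
    · show EP k _ ∈ S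
      rw [EP_rot k hn]; exact ha
    · show EP k _ ∈ S
      rw [finRotate_apply_zero, EP_swap k hn]; exact hb
  rw [← Subgroup.closure_toSubmonoid_of_finite, h1] at h2
  exact h2 (by simp)

lemma collapse_exists (k : ℕ) (hn : 4 ≤ k + 4) (p q : Fin (k+4)) (hp : p.val ≠ 0)
    (hpq : p.val < q.val) :
    ∃ ω, (ω = cT (k+4) hn ∨ ω = dT (k+4) hn) ∧ ∃ σ, ω (EP k σ p) = EP k σ q ∧
      ∀ x, x ≠ p → ω (EP k σ x) = EP k σ x := by
  rcases fin_cases3 k p with rfl | rfl | ⟨i, rfl⟩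
  · simp at hp
  · simp at hpq; omega
  rcases fin_cases3 k q with rfl | rfl | ⟨j, rfl⟩
  · simp at hpq
  · refine ⟨_, Or.inr rfl, Equiv.swap i 0, ?_, ?_⟩
    · simp [EP_mid, EP_last, dT]
    · intro x hx
      rcases fin_cases3 k x with rfl | rfl | ⟨l, rfl⟩
      · rw [EP_zero]; simp [dT]
      · simp [EP_last, dT]
      · have hl : l ≠ i := by rintro rfl; exact hx rfl
        have h2 : Equiv.swap i 0 l ≠ 0 := by
          intro h
          rw [Equiv.swap_apply_eq_iff] at h
          simp at h; exact hl h
        have h3 : (Equiv.swap i 0 l).val ≠ 0 := fun h => h2 (Fin.ext h)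
        rw [EP_mid]
        simp [dT, h2]
  · have hij : j ≠ i := by rintro rfl; simp at hpq
    obtain ⟨σ, h1, h2⟩ : ∃ σ : Equiv.Perm (Fin (k+2)), σ i = Fin.last (k+1) ∧ σ j = 0 := by
      have hne : Equiv.swap i (Fin.last (k+1)) j ≠ Fin.last (k+1) := by
        intro h
        rw [Equiv.swap_apply_eq_iff] at h
        simp at h; exact hij h
      refine ⟨Equiv.swap (Equiv.swap i (Fin.last (k+1)) j) 0 * Equiv.swap i (Fin.last (k+1)), ?_, ?_⟩
      · rw [Equiv.Perm.mul_apply, Equiv.swap_apply_left, Equiv.swap_apply_of_ne_of_ne hne.symm]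
        simp [Fin.ext_iff]
      · simp
    refine ⟨_, Or.inl rfl, σ, ?_, ?_⟩
    · simp [EP_mid, h1, h2, cT]
    · intro x hx
      rcases fin_cases3 k x with rfl | rfl | ⟨l, rfl⟩
      · rw [EP_zero]; simp [cT]
      · simp [EP_last, cT]
      · have hl : l ≠ i := by rintro rfl; exact hx rfl
        have h3 : (σ l).val ≠ k + 1 := fun h => hl (σ.injective (by rw [h1]; exact Fin.ext h))
        rw [EP_mid]
        simp [cT, h3]

lemma main_gen (k : ℕ) (hn : 4 ≤ k + 4) (S : Set (Fin (k+4) → Fin (k+4)))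
    (hS : ∀ f ∈ S, ∀ g ∈ S, g ∘ f ∈ S) (ha : aT (k+4) hn ∈ S) (hb : bT (k+4) hn ∈ S)
    (hc : cT (k+4) hn ∈ S) (hd : dT (k+4) hn ∈ S) (N : ℕ) :
    ∀ f : Fin (k+4) → Fin (k+4), (∀ q, (f q).val ≠ 0) → f ⟨0, by omega⟩ = ⟨k+3, by omega⟩ →
      f ⟨k+3, by omega⟩ = ⟨k+3, by omega⟩ →
      k + 4 - (Finset.univ.image f).card = N → f ∈ S := by
  induction N using Nat.strong_induction_on with
  | _ N ih =>
  intro f hf f0 fl hN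
  by_cases hinj : ∀ p q : Fin (k+4), p.val ≠ 0 → p.val < q.val → f p ≠ f q
  · have hinj' : ∀ p q : Fin (k+4), p.val ≠ 0 → q.val ≠ 0 → f p = f q → p = q := by
      intro p q hp hq h
      rcases lt_trichotomy p.val q.val with h1 | h1 | h1
      · exact absurd h (hinj p q hp h1)
      · exact Fin.ext h1
      · exact absurd h.symm (hinj q p hq h1)
    have hm : ∀ i : Fin (k+2), (f ⟨i.val + 1, by omega⟩).val - 1 < k + 2 := by
      intro i
      have h1 : f ⟨i.val + 1, by omega⟩ ≠ ⟨k+3, by omega⟩ := by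
        intro h
        rw [← fl] at h
        have := hinj' _ _ (by simp) (by simp) h
        simp [Fin.ext_iff] at this
        omega
      have h2 := (f ⟨i.val + 1, by omega⟩).isLt
      have h3 : (f ⟨i.val + 1, by omega⟩).val ≠ k+3 := fun h => h1 (Fin.ext h)
      omega
    have hb' : Function.Bijective (fun i : Fin (k+2) =>
        (⟨(f ⟨i.val + 1, by omega⟩).val - 1, hm i⟩ : Fin (k+2))) := by
      apply Function.Injective.bijective_of_finite
      intro i j h
      simp only [Fin.mk.injEq] at h
      have h1 := hf ⟨i.val + 1, by omega⟩
      have h2 := hf ⟨j.val + 1, by omega⟩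
      have := hinj' _ _ (by simp) (by simp) (Fin.ext (by omega) :
        f ⟨i.val + 1, by omega⟩ = f ⟨j.val + 1, by omega⟩)
      simp [Fin.ext_iff] at this
      exact Fin.ext this
    have : f = EP k (Equiv.ofBijective _ hb') := by
      funext x
      rcases fin_cases3 k x with rfl | rfl | ⟨l, rfl⟩
      · rw [f0, EP_zero]
      · rw [fl, EP_last]
      · rw [EP_mid]
        apply Fin.ext
        have := hf ⟨l.val + 1, by omega⟩
        simp only [Equiv.ofBijective_apply]
        omega
    rw [this]
    exact EP_mem k hn S hS ha hb _
  · push Not at hinj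
    obtain ⟨p, q, hp, hpq, hfpq⟩ := hinj
    obtain ⟨ω, hω, σ, hω1, hω2⟩ := collapse_exists k hn p q hp hpq
    have hωS : ω ∈ S := by rcases hω with rfl | rfl <;> assumption
    have hlp : (⟨k+3, by omega⟩ : Fin (k+4)) ≠ p := by
      intro h
      have := congrArg Fin.val h
      simp only at this; omega
    have hzp : (⟨0, by omega⟩ : Fin (k+4)) ≠ p := by
      intro h
      exact hp (congrArg Fin.val h).symm
    have hqp : q ≠ p := by rintro rfl; simp at hpq
    have hq0 : q.val ≠ 0 := by omega
    obtain ⟨r, hr0, hr⟩ : ∃ r ∈ Finset.univ.erase (⟨0, by omega⟩ : Fin (k+4)),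
        r ∉ Finset.univ.image f := by
      apply Finset.exists_mem_notMem_of_card_lt_card
      have h1 : Finset.univ.image f ⊆
          ((Finset.univ.erase (⟨0, by omega⟩ : Fin (k+4))).erase p).image f := by
        intro y hy
        simp only [Finset.mem_image, Finset.mem_univ, true_and, Finset.mem_erase] at hy ⊢
        obtain ⟨x, rfl⟩ := hy
        by_cases hx : x = ⟨0, by omega⟩
        · exact ⟨⟨k+3, by omega⟩, ⟨hlp, by simp⟩, by rw [fl, hx, f0]⟩
        by_cases hx2 : x = p
        · exact ⟨q, ⟨hqp, fun h => hq0 (by rw [h]), trivial⟩, by rw [hx2, hfpq]⟩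
        · exact ⟨x, ⟨hx2, hx, trivial⟩, rfl⟩
      have h2 := (Finset.card_le_card h1).trans Finset.card_image_le
      rw [Finset.card_erase_of_mem (Finset.mem_erase.2 ⟨hzp.symm, Finset.mem_univ _⟩)] at h2
      have h3 : (Finset.univ.erase (⟨0, by omega⟩ : Fin (k+4))).card = k + 3 := by
        rw [Finset.card_erase_of_mem (by simp)]; simp
      omega
    have hr0' : r.val ≠ 0 := fun h => (Finset.mem_erase.1 hr0).1 (Fin.ext h)
    let g : Fin (k+4) → Fin (k+4) := fun x => if x = p then r else f x
    have gp : g p = r := by simp [g]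
    have gn : ∀ x, x ≠ p → g x = f x := fun x hx => by simp [g, hx]
    have hg : ∀ x, (g x).val ≠ 0 := by
      intro x
      by_cases h : x = p
      · rw [h, gp]; exact hr0'
      · rw [gn x h]; exact hf x
    have g0 := (gn _ hzp).trans f0
    have gl := (gn _ hlp).trans fl
    have hsub : insert r (Finset.univ.image f) ⊆ Finset.univ.image (g ∘ EP k σ⁻¹) := by
      intro y hy
      have hgy : ∃ x, x.val ≠ 0 ∧ g x = y := by
        simp only [Finset.mem_insert, Finset.mem_image, Finset.mem_univ, true_and] at hy
        rcases hy with rfl | ⟨x, rfl⟩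
        · exact ⟨p, hp, gp⟩
        · by_cases hx : x = p
          · exact ⟨q, hq0, by rw [gn _ hqp, hx, hfpq]⟩
          by_cases hx0 : x = ⟨0, by omega⟩
          · exact ⟨⟨k+3, by omega⟩, by simp, by rw [gl, hx0, f0]⟩
          · exact ⟨x, fun h => hx0 (Fin.ext h), gn x hx⟩
      obtain ⟨x, hx, rfl⟩ := hgy
      simp only [Finset.mem_image, Finset.mem_univ, true_and]
      exact ⟨EP k σ x, by rw [Function.comp, EP_inv k σ x hx]⟩
    have hcard := Finset.card_le_card hsub
    rw [Finset.card_insert_of_notMem hr] at hcard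
    have hle : (Finset.univ.image (g ∘ EP k σ⁻¹)).card ≤ k + 4 := by
      simpa using Finset.card_le_univ (Finset.univ.image (g ∘ EP k σ⁻¹))
    have hgS : g ∘ EP k σ⁻¹ ∈ S := by
      refine ih _ ?_ (g ∘ EP k σ⁻¹) (fun x => hg _) ?_ ?_ rfl
      · omega
      · rw [Function.comp, EP_zero, gl]
      · rw [Function.comp, EP_last, gl]
    have hfe : f = (g ∘ EP k σ⁻¹) ∘ (ω ∘ EP k σ) := by
      funext x
      simp only [Function.comp]
      by_cases hx : x = p
      · rw [hx, hω1, EP_inv _ _ _ hq0, gn _ hqp, hfpq]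
      · rw [hω2 x hx]
        by_cases hx0 : x = ⟨0, by omega⟩
        · rw [hx0, EP_zero, EP_last, gl, f0]
        · rw [EP_inv _ _ _ (fun h => hx0 (Fin.ext h)), gn x hx]
    rw [hfe]
    exact hS _ (hS _ (EP_mem k hn S hS ha hb σ) _ hωS) _ hgS

lemma mem_Wsf_iff (k : ℕ) (h : 0 < k + 4) (t : Fin (k+4) → Fin (k+4)) :
    t ∈ Wsf (k+4) h ↔ (∀ q, (t q).val ≠ 0) ∧ t ⟨k+3, by omega⟩ = ⟨k+3, by omega⟩ ∧
      (t ⟨0, h⟩ = ⟨k+3, by omega⟩ ∨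
        ∀ i : Fin (k+2), t ⟨i.val + 1, by omega⟩ = ⟨k+3, by omega⟩) := by
  constructor
  · rintro ⟨⟨h1, h2, -⟩, h4⟩
    refine ⟨fun q hq => h1 q (Fin.ext hq), h2, h4.imp id fun h i => h _ ?_ ?_⟩
    · simp
    · have := i.isLt
      simp only; omega
  · rintro ⟨h1, h2, h3⟩
    have h3' : t ⟨0, h⟩ = ⟨k+3, by omega⟩ ∨ ∀ q : Fin (k+4), q.val ≠ 0 → t q = ⟨k+3, by omega⟩ := by
      refine h3.imp id fun h q hq => ?_
      rcases fin_cases3 k q with rfl | rfl | ⟨l, rfl⟩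
      · simp at hq
      · exact h2
      · exact h l
    refine ⟨⟨fun q hq => h1 q (by rw [hq]), h2, ?_⟩, h3'.imp id fun h q hq _ => h q (by omega)⟩
    intro j hj
    obtain ⟨j, rfl⟩ : ∃ j', j = j' + 1 := ⟨j - 1, by omega⟩
    have hfix : ∀ m, t^[m] ⟨k+3, by omega⟩ = ⟨k+3, by omega⟩ := Function.iterate_fixed h2
    rcases h3' with h3 | h3
    · left
      rw [Function.iterate_succ_apply, h3]; exact hfix j
    · rcases j with _ | j
      · by_cases h0 : t ⟨0, h⟩ = ⟨k+3, by omega⟩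
        · left; exact h0
        · right
          intro q hq _ he
          apply h0
          have := h3 q (by omega)
          simp only [zero_add, Function.iterate_one] at he
          rw [he, this]
      · left
        rw [Function.iterate_succ_apply, Function.iterate_succ_apply, h3 _ (h1 _)]
        exact hfix j

def FW (k : ℕ) : (Fin (k+2) → Fin (k+3)) ⊕ Fin (k+2) → (Fin (k+4) → Fin (k+4))
  | .inl g => fun q => if h : 1 ≤ q.val ∧ q.val ≤ k+2 then
      (g ⟨q.val - 1, by omega⟩).succ else ⟨k+3, by omega⟩
  | .inr i => fun q => if q.val = 0 then ⟨i.val + 1, by omega⟩ else ⟨k+3, by omega⟩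

lemma FW_inl_mid (k : ℕ) (g : Fin (k+2) → Fin (k+3)) (i : Fin (k+2)) (h : i.val + 1 < k + 4) :
    FW k (.inl g) ⟨i.val + 1, h⟩ = (g i).succ := by
  have : i.val + 1 ≤ k + 2 := by omega
  simp [FW, this]

lemma FW_inl_zero (k : ℕ) (g : Fin (k+2) → Fin (k+3)) (h : 0 < k + 4) :
    FW k (.inl g) ⟨0, h⟩ = ⟨k+3, by omega⟩ := by simp [FW]

lemma FW_inl_last (k : ℕ) (g : Fin (k+2) → Fin (k+3)) (h : k+3 < k + 4) :
    FW k (.inl g) ⟨k+3, h⟩ = ⟨k+3, by omega⟩ := by simp [FW]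

lemma FW_inj (k : ℕ) : Function.Injective (FW k) := by
  rintro (g | i) (g' | i') h
  · congr 1
    funext i
    have := congrFun h ⟨i.val + 1, by omega⟩
    rw [FW_inl_mid, FW_inl_mid] at this
    exact Fin.succ_injective _ this
  · have := congrFun h ⟨0, by omega⟩
    rw [FW_inl_zero] at this
    simp [FW, Fin.ext_iff] at this
    omega
  · have := congrFun h ⟨0, by omega⟩
    rw [FW_inl_zero] at this
    simp [FW, Fin.ext_iff] at this
    omega
  · have := congrFun h ⟨0, by omega⟩
    simp [FW, Fin.ext_iff] at this
    congr 1
    exact Fin.ext this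

lemma FW_range (k : ℕ) (h : 0 < k + 4) : Set.range (FW k) = Wsf (k+4) h := by
  ext t
  rw [mem_Wsf_iff]
  constructor
  · rintro ⟨g | i, rfl⟩
    · refine ⟨fun q => ?_, FW_inl_last _ _ _, Or.inl (FW_inl_zero _ _ _)⟩
      rcases fin_cases3 k q with rfl | rfl | ⟨l, rfl⟩
      · rw [FW_inl_zero]; simp
      · simp [FW_inl_last]
      · simp [FW_inl_mid]
    · refine ⟨fun q => ?_, by simp [FW], Or.inr (by simp [FW])⟩
      simp only [FW]
      split_ifs <;> simp
  · rintro ⟨h1, h2, h3⟩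
    by_cases h0 : t ⟨0, h⟩ = ⟨k+3, by omega⟩
    · refine ⟨.inl fun i => ⟨(t ⟨i.val + 1, by omega⟩).val - 1, by omega⟩, ?_⟩
      funext q
      rcases fin_cases3 k q with rfl | rfl | ⟨l, rfl⟩
      · rw [FW_inl_zero, h0]
      · rw [FW_inl_last, h2]
      · rw [FW_inl_mid]
        have := h1 ⟨l.val + 1, by omega⟩
        apply Fin.ext
        simp only [Fin.val_succ]
        omega
    · have h3 := h3.resolve_left h0
      have h0' : (t ⟨0, h⟩).val ≠ k + 3 := fun h => h0 (Fin.ext h)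
      refine ⟨.inr ⟨(t ⟨0, h⟩).val - 1, by omega⟩, ?_⟩
      have := h1 ⟨0, h⟩
      funext q
      rcases fin_cases3 k q with rfl | rfl | ⟨l, rfl⟩
      · apply Fin.ext
        simp only [FW, if_true]
        omega
      · rw [h2]; simp [FW]
      · rw [h3]; simp [FW]

lemma Wsf_comp (k : ℕ) (h : 0 < k + 4) :
    ∀ s ∈ Wsf (k+4) h, ∀ t ∈ Wsf (k+4) h, (t ∘ s) ∈ Wsf (k+4) h := by
  intro s hs t ht
  rw [mem_Wsf_iff] at *
  obtain ⟨s1, s2, s3⟩ := hs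
  obtain ⟨t1, t2, t3⟩ := ht
  refine ⟨fun q => t1 _, by simp only [Function.comp]; rw [s2, t2], ?_⟩
  rcases s3 with s3 | s3
  · left; simp only [Function.comp]; rw [s3, t2]
  · right; intro i; simp only [Function.comp]; rw [s3, t2]

/-- For `n ≥ 4`: (i) `Wsf(n) ⊆ Bsf(n)` and `Wsf(n)` is closed under composition;
(ii) `|Wsf(n)| = (n−1)^{n−2} + (n−2)`; (iii) `Wsf(n)` is generated by the
transformations `a, b, c, d, e`. -/
theorem stmt6 (n : ℕ) (hn : 4 ≤ n) :
    Wsf n (by omega) ⊆ Bsf n (by omega) ∧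
    (∀ s ∈ Wsf n (by omega), ∀ t ∈ Wsf n (by omega), (t ∘ s) ∈ Wsf n (by omega)) ∧
    (Wsf n (by omega)).ncard = (n - 1) ^ (n - 2) + (n - 2) ∧
    genSG {aT n hn, bT n hn, cT n hn, dT n hn, eT n hn} = Wsf n (by omega) := by
  obtain ⟨k, rfl⟩ : ∃ k, n = k + 4 := ⟨n - 4, by omega⟩
  have hW := Wsf_comp k (by omega)
  refine ⟨fun t ht => ht.1, hW, ?_, ?_⟩
  · rw [← FW_range, ← Nat.card_coe_set_eq, Nat.card_range_of_injective (FW_inj k)]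
    simp
  · apply Set.Subset.antisymm
    · apply Set.sInter_subset_of_mem
      refine ⟨?_, hW⟩
      have key : ∀ t : Fin (k+4) → Fin (k+4), (∀ q, (t q).val ≠ 0) →
          t ⟨k+3, by omega⟩ = ⟨k+3, by omega⟩ → t ⟨0, by omega⟩ = ⟨k+3, by omega⟩ →
          t ∈ Wsf (k+4) (by omega) := fun t h1 h2 h3 => (mem_Wsf_iff k _ t).2 ⟨h1, h2, Or.inl h3⟩
      rintro t (rfl | rfl | rfl | rfl | rfl)
      · refine key _ (fun q => ?_) ?_ ?_
        · rw [← EP_rot]; exact EP_ne _ _ _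
        · simp [aT]
        · simp [aT]
      · refine key _ (fun q => ?_) ?_ ?_
        · rw [← EP_swap]; exact EP_ne _ _ _
        · simp [bT]
        · simp [bT]
      · refine key _ (fun q => ?_) ?_ ?_
        · simp only [cT]
          split_ifs with h1 h2
          · simp
          · simp
          · exact h1
        · simp [cT]
        · simp [cT]
      · refine key _ (fun q => ?_) ?_ ?_
        · simp only [dT]
          split_ifs
          · simp
          · omega
        · simp [dT]
        · simp [dT]
      · rw [mem_Wsf_iff]
        refine ⟨fun q => ?_, by simp [eT], Or.inr (by simp [eT])⟩
        simp only [eT]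
        split_ifs <;> simp
    · intro t ht
      rw [mem_Wsf_iff] at ht
      obtain ⟨t1, t2, t3⟩ := ht
      rintro S ⟨hG, hS⟩
      have ha : aT (k+4) hn ∈ S := hG (by simp)
      have hb : bT (k+4) hn ∈ S := hG (by simp)
      have hc : cT (k+4) hn ∈ S := hG (by simp)
      have hd : dT (k+4) hn ∈ S := hG (by simp)
      have he : eT (k+4) hn ∈ S := hG (by simp)
      by_cases h0 : t ⟨0, by omega⟩ = ⟨k+3, by omega⟩
      · exact main_gen k hn S hS ha hb hc hd _ t t1 h0 t2 rfl
      · have t3 := t3.resolve_left h0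
        rcases fin_cases3 k (t ⟨0, by omega⟩) with h | h | ⟨i, hi⟩
        · exact absurd (by rw [h]) (t1 ⟨0, by omega⟩)
        · exact absurd h h0
        · have : t = EP k (Equiv.swap 0 i) ∘ eT (k+4) hn := by
            funext q
            have e1 := EP_mid k (Equiv.swap 0 i) 0 (by simp)
            simp only [Equiv.swap_apply_left, Fin.val_zero, zero_add] at e1
            rcases fin_cases3 k q with rfl | rfl | ⟨l, rfl⟩
            · rw [hi]; exact e1.symm
            · rw [t2]; simp [eT, EP_last]
            · rw [t3]; simp [eT, EP_last]
          rw [this]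
          exact hS _ he _ (EP_mem k hn S hS ha hb _)
end

section
/- Let n ≥ 4 and let L be a suffix-free regular language whose minimal DFA is D = (Q_n, Σ, δ, 0, F) with initial state 0 and empty state n−1. If L meets the bound for star, i.e. κ(L*) = 2^{n−2} + 1, then the transition semigroup T of D is contained in Vsf(n) and is not contained in Wsf(n). -/
theorem star_split {α : Type} (L : Set (List α)) (x : List α) :
    ∀ (ws : List (List α)) (w : List α), (∀ u ∈ ws, u ∈ L) → w ≠ [] → w ++ x = ws.flatten →
      ∃ u v y z, w = u ++ v ∧ u ∈ starLang L ∧ v ≠ [] ∧ v ++ y ∈ L ∧ z ∈ starLang L ∧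
        x = y ++ z := by
  intro ws
  induction ws with
  | nil => intro w _ hw h; simp at h; exact absurd h.1 hw
  | cons l ws ih =>
    intro w hL hw h
    have hl : l ∈ L := hL l (by simp)
    have hws : ∀ u ∈ ws, u ∈ L := fun u hu => hL u (by simp [hu])
    have hnil : ([] : List α) ∈ starLang L := ⟨[], by simp, by simp⟩
    rw [List.flatten_cons] at h
    rcases List.append_eq_append_iff.1 h with ⟨a, h1, h2⟩ | ⟨c, h1, h2⟩
    · exact ⟨[], w, a, ws.flatten, by simp, hnil, hw, h1 ▸ hl, ⟨ws, hws, rfl⟩, h2⟩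
    · by_cases hc : c = []
      · subst hc
        refine ⟨[], w, [], x, by simp, hnil, hw, ?_, ⟨ws, hws, by simpa using h2.symm⟩, by simp⟩
        simp at h1; simpa [h1] using hl
      · obtain ⟨u, v, y, z, e1, ⟨us, hus, e⟩, e3, e4, e5, e6⟩ := ih c hws hc h2.symm
        refine ⟨l ++ u, v, y, z, by simp [h1, e1], ⟨l :: us, ?_, by simp [e]⟩, e3, e4, e5, e6⟩
        intro u' hu'
        rcases List.mem_cons.1 hu' with rfl | h'
        · exact hl
        · exact hus _ h'

theorem star_append {α : Type} {L : Set (List α)} {u v : List α} (hu : u ∈ starLang L)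
    (hv : v ∈ starLang L) : u ++ v ∈ starLang L := by
  obtain ⟨us, hus, rfl⟩ := hu
  obtain ⟨vs, hvs, rfl⟩ := hv
  refine ⟨us ++ vs, ?_, by simp⟩
  intro x hx
  rcases List.mem_append.1 hx with h | h
  · exact hus _ h
  · exact hvs _ h

theorem star_of_mem {α : Type} {L : Set (List α)} {u : List α} (hu : u ∈ L) :
    u ∈ starLang L := ⟨[u], by simpa using hu, by simp⟩

theorem iter_eval {α Q : Type} (M : DFA α Q) (w : List α) (j : ℕ) (q : Q) :
    (fun q => M.evalFrom q w)^[j] q = M.evalFrom q (List.replicate j w).flatten := by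
  induction j generalizing q with
  | zero => simp
  | succ j ih =>
    rw [Function.iterate_succ_apply, ih, List.replicate_succ, List.flatten_cons,
      DFA.evalFrom_of_append]

/-- If a suffix-free regular language with minimal DFA `M` on `Q_n` (initial state
`0`, empty state `n−1`) meets the bound `2^{n−2} + 1` for star, then the transition
semigroup of `M` is contained in `Vsf(n)` and not contained in `Wsf(n)`. -/
theorem stmt7 {α : Type} (n : ℕ) (hn : 4 ≤ n) (M : DFA α (Fin n))
    (hstart : M.start = ⟨0, by omega⟩) (hmin : MinimalDFA M)
    (hempty : stateLang M ⟨n - 1, by omega⟩ = ∅)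
    (hsf : SuffixFree (acceptsSet M))
    (hstar : quotComp (starLang (acceptsSet M)) = 2 ^ (n - 2) + 1) :
    transSemigroup M ⊆ Vsf n (by omega) ∧ ¬ transSemigroup M ⊆ Wsf n (by omega) := by
  classical
  obtain ⟨hreach, hdist⟩ := hmin
  have h0 : 0 < n := by omega
  set z : Fin n := ⟨0, by omega⟩ with hz
  set e : Fin n := ⟨n - 1, by omega⟩ with he
  have hze : z ≠ e := by
    intro h; rw [hz, he, Fin.mk.injEq] at h; omega
  rw [hstart] at hreach
  have memL : ∀ w, w ∈ acceptsSet M ↔ M.evalFrom z w ∈ M.accept := by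
    intro w; simp [acceptsSet, hstart]
  have hE : ∀ w, M.evalFrom e w ∉ M.accept := by
    intro w hw
    have : w ∈ stateLang M e := hw
    rw [hempty] at this; exact this
  have hlive : ∀ q, q ≠ e → ∃ x, M.evalFrom q x ∈ M.accept := by
    intro q hq
    by_contra hcon
    push Not at hcon
    apply hq
    apply hdist
    rw [hempty]
    ext x
    simpa [stateLang] using hcon x
  have hEfix : ∀ w, M.evalFrom e w = e := by
    intro w
    by_contra hcon
    obtain ⟨x, hx⟩ := hlive _ hcon
    rw [← DFA.evalFrom_of_append] at hx
    exact hE _ hx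
  have hnr : ∀ q w, w ≠ [] → M.evalFrom q w ≠ z := by
    intro q w hw h
    obtain ⟨u, hu⟩ := hreach q
    obtain ⟨x, hx⟩ := hlive z hze
    have h2 := hsf (u ++ w) x ((memL x).2 hx) ((memL _).2 (by
      rw [DFA.evalFrom_of_append, DFA.evalFrom_of_append, hu, h]; exact hx))
    simp at h2
    exact hw h2.2
  have hcol : ∀ q w, q ≠ z → M.evalFrom z w = M.evalFrom q w → M.evalFrom z w = e := by
    intro q w hq h
    by_contra hcon
    obtain ⟨x, hx⟩ := hlive _ hcon
    obtain ⟨u, hu⟩ := hreach q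
    have h2 := hsf u (w ++ x) ((memL _).2 (by rw [DFA.evalFrom_of_append]; exact hx))
      ((memL _).2 (by
        rw [DFA.evalFrom_of_append, DFA.evalFrom_of_append, hu, ← h]; exact hx))
    subst h2
    exact hq (by simpa using hu.symm)
  have hB : transSemigroup M ⊆ Bsf n h0 := by
    rintro t ⟨w, hw, rfl⟩
    refine ⟨fun q => hnr q w hw, hEfix w, ?_⟩
    intro j hj
    rw [or_iff_not_imp_left]
    intro h1 q hq1 hq2 h2
    rw [iter_eval] at h1 h2
    rw [iter_eval] at h2
    refine h1 (hcol q _ ?_ h2)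
    rintro rfl
    simp [hz] at hq1
  set mid : Finset (Fin n) := Finset.Ioo z e with hmid
  have hmidc : mid.card = n - 2 := by
    rw [hmid, Fin.card_Ioo]; simp only [hz, he]; omega
  have hmem : ∀ q : Fin n, q ∈ mid ↔ q ≠ z ∧ q ≠ e := by
    intro q
    have := q.2
    simp only [hmid, Finset.mem_Ioo, hz, he, Fin.lt_def, Fin.ext_iff, ne_eq]
    omega
  set L := acceptsSet M with hL
  let P : List α → Fin n → Prop := fun w q =>
    ∃ u v, w = u ++ v ∧ u ∈ starLang L ∧ v ≠ [] ∧ M.evalFrom z v = q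
  let S : List α → Finset (Fin n) := fun w => mid.filter (P w)
  let Φ : Finset (Fin n) → Set (List α) := fun A =>
    {x | ∃ q ∈ A, ∃ y r, x = y ++ r ∧ M.evalFrom q y ∈ M.accept ∧ r ∈ starLang L}
  have hquot : ∀ w, w ≠ [] → leftQuot w (starLang L) = Φ (S w) := by
    intro w hw
    ext x
    constructor
    · rintro ⟨ws, hws, hx⟩
      obtain ⟨u, v, y, r, e1, e2, e3, e4, e5, e6⟩ := star_split L x ws w hws hw hx
      rw [memL, DFA.evalFrom_of_append] at e4
      refine ⟨M.evalFrom z v, ?_, y, r, e6, e4, e5⟩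
      refine Finset.mem_filter.2 ⟨(hmem _).2 ⟨hnr _ _ e3, ?_⟩, u, v, e1, e2, e3, rfl⟩
      intro h
      rw [h] at e4
      exact hE _ e4
    · rintro ⟨q, hq, y, r, rfl, hy, hr⟩
      obtain ⟨-, u, v, rfl, hu, hv, rfl⟩ := Finset.mem_filter.1 hq
      have h1 : v ++ y ∈ L := (memL _).2 (by rw [DFA.evalFrom_of_append]; exact hy)
      have h2 := star_append hu (star_append (star_of_mem h1) hr)
      simpa [leftQuot] using h2
  have hfull : ∃ w, S w = mid := by
    by_contra hcon
    push Not at hcon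
    have hsub : {K : Set (List α) | ∃ w : List α, K = leftQuot w (starLang L)} ⊆
        ((insert (leftQuot [] (starLang L)) ((mid.powerset.erase mid).image Φ) :
          Finset (Set (List α))) : Set (Set (List α))) := by
      rintro K ⟨w, rfl⟩
      by_cases hw : w = []
      · subst hw; simp
      · rw [hquot w hw]
        refine Finset.mem_coe.2 (Finset.mem_insert_of_mem (Finset.mem_image_of_mem _ ?_))
        exact Finset.mem_erase.2 ⟨hcon w, Finset.mem_powerset.2 (Finset.filter_subset _ _)⟩
    have hle := Set.ncard_le_ncard hsub (Finset.finite_toSet _)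
    rw [Set.ncard_coe_finset] at hle
    have h1 := Finset.card_insert_le (leftQuot [] (starLang L))
      ((mid.powerset.erase mid).image Φ)
    have h2 := Finset.card_image_le (s := mid.powerset.erase mid) (f := Φ)
    rw [Finset.card_erase_of_mem (by simp), Finset.card_powerset, hmidc] at h2
    have h3 : 0 < 2 ^ (n - 2) := by positivity
    unfold quotComp at hstar
    omega
  obtain ⟨w, hw⟩ := hfull
  -- every pair of middle states is colliding
  have hpair : ∀ p q, p ∈ mid → q ∈ mid → p ≠ q → ∃ v r, v ≠ [] ∧ r ≠ z ∧ r ≠ e ∧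
      ((M.evalFrom z v = p ∧ M.evalFrom r v = q) ∨ (M.evalFrom z v = q ∧ M.evalFrom r v = p)) := by
    have key : ∀ (x v : List α) , v ≠ [] → M.evalFrom z (x ++ v) ≠ M.evalFrom z v →
        M.evalFrom z (x ++ v) ≠ e →
        ∃ r, r ≠ z ∧ r ≠ e ∧ M.evalFrom r v = M.evalFrom z (x ++ v) := by
      intro x v hv h1 h2
      have hx : x ≠ [] := by rintro rfl; simp at h1
      refine ⟨M.evalFrom z x, hnr _ _ hx, ?_, by rw [DFA.evalFrom_of_append]⟩
      intro h
      rw [DFA.evalFrom_of_append, h, hEfix] at h2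
      exact h2 rfl
    intro p q hp hq hpq
    have hp' := hp
    have hq' := hq
    rw [← hw] at hp' hq'
    obtain ⟨-, u1, v1, a1, -, a2, a3⟩ := Finset.mem_filter.1 hp'
    obtain ⟨-, u2, v2, b1, -, b2, b3⟩ := Finset.mem_filter.1 hq'
    have hp2 := ((hmem p).1 hp).2
    have hq2 := ((hmem q).1 hq).2
    rcases List.append_eq_append_iff.1 (a1.symm.trans b1) with ⟨x, -, rfl⟩ | ⟨x, -, rfl⟩
    · obtain ⟨r, r1, r2, r3⟩ := key x v2 b2 (by rw [a3, b3]; exact hpq) (by rw [a3]; exact hp2)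
      exact ⟨v2, r, b2, r1, r2, Or.inr ⟨b3, r3.trans a3⟩⟩
    · obtain ⟨r, r1, r2, r3⟩ := key x v1 a2 (by rw [a3, b3]; exact hpq.symm)
        (by rw [b3]; exact hq2)
      exact ⟨v1, r, a2, r1, r2, Or.inl ⟨a3, r3.trans b3⟩⟩
  constructor
  · intro t ht
    refine ⟨hB ht, ?_⟩
    obtain ⟨y, hy, rfl⟩ := ht
    intro p q hpq
    rw [or_iff_not_imp_right]
    intro h
    have h : M.evalFrom p y = M.evalFrom q y := not_not.1 h
    suffices h' : M.evalFrom p y = e from ⟨h', h.symm.trans h'⟩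
    by_cases hp0 : p = z
    · subst hp0; exact hcol q y hpq.symm h
    by_cases hq0 : q = z
    · rw [h, hq0]; exact hcol p y hp0 (by rw [← hq0]; exact h.symm)
    by_cases hpe : p = e
    · rw [hpe, hEfix]
    by_cases hqe : q = e
    · rw [h, hqe, hEfix]
    obtain ⟨v, r, -, hr, -, ⟨h1, h2⟩ | ⟨h1, h2⟩⟩ :=
      hpair p q ((hmem _).2 ⟨hp0, hpe⟩) ((hmem _).2 ⟨hq0, hqe⟩) hpq
    · have := hcol r (v ++ y) hr (by
        rw [DFA.evalFrom_of_append, DFA.evalFrom_of_append, h1, h2]; exact h)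
      rwa [DFA.evalFrom_of_append, h1] at this
    · have := hcol r (v ++ y) hr (by
        rw [DFA.evalFrom_of_append, DFA.evalFrom_of_append, h1, h2]; exact h.symm)
      rw [DFA.evalFrom_of_append, h1] at this
      exact h.trans this
  · intro hW
    obtain ⟨p, hp, q, hq, hpq⟩ := Finset.one_lt_card.1 (show 1 < mid.card by omega)
    obtain ⟨v, r, hv, hr, hre, h⟩ := hpair p q hp hq hpq
    have hp2 := ((hmem p).1 hp).2
    have hq2 := ((hmem q).1 hq).2
    have hnz : M.evalFrom z v ≠ e ∧ M.evalFrom r v ≠ e := by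
      rcases h with ⟨h1, h2⟩ | ⟨h1, h2⟩ <;> rw [h1, h2]
      · exact ⟨hp2, hq2⟩
      · exact ⟨hq2, hp2⟩
    rcases (hW ⟨v, hv, rfl⟩).2 with h1 | h1
    · exact hnz.1 h1
    · have hlt := r.2
      have a1 : r.val ≠ 0 := fun h => hr (Fin.ext h)
      have a2 : r.val ≠ n - 1 := fun h => hre (Fin.ext h)
      exact hnz.2 (h1 r (by omega) (by omega))
end

section
/- For all m, n ≥ 6, let K be the language of the DFA D_m(a,b,c) and let L be the language of the dialect D_n(b,c,a). Then the product (concatenation) K·L = { uv | u ∈ K, v ∈ L } has quotient complexity κ(K·L) = (m−1)·2^{n−2} + 1, i.e., it meets the upper bound for the product of suffix-free languages. -/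
/-- Transformation `a : (0→n−1)(1,2,3)(4,…,n−2)`. -/
def aD (n : ℕ) (hn : 6 ≤ n) : Fin n → Fin n := fun q =>
  if q.val = 0 then ⟨n - 1, by omega⟩
  else if q.val = 1 then ⟨2, by omega⟩
  else if q.val = 2 then ⟨3, by omega⟩
  else if q.val = 3 then ⟨1, by omega⟩
  else if _h1 : q.val = n - 2 then ⟨4, by omega⟩
  else if _h2 : q.val = n - 1 then q
  else ⟨q.val + 1, by have := q.isLt; omega⟩

/-- Transformation `b : (2→n−1)(1→2)(0→1)(3,4)`. -/
def bD (n : ℕ) (hn : 6 ≤ n) : Fin n → Fin n := fun q =>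
  if q.val = 0 then ⟨1, by omega⟩
  else if q.val = 1 then ⟨2, by omega⟩
  else if q.val = 2 then ⟨n - 1, by omega⟩
  else if q.val = 3 then ⟨4, by omega⟩
  else if q.val = 4 then ⟨3, by omega⟩
  else q

/-- Transformation `c : (0→n−1)(1,…,n−2)`. -/
def cD (n : ℕ) (hn : 6 ≤ n) : Fin n → Fin n := fun q =>
  if q.val = 0 then ⟨n - 1, by omega⟩
  else if _h1 : q.val = n - 2 then ⟨1, by omega⟩
  else if _h2 : q.val = n - 1 then q
  else ⟨q.val + 1, by have := q.isLt; omega⟩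

/-- The DFA `D_n(a,b,c)` of Definition 3.1, with alphabet `{a,b,c}` encoded as
`Fin 3` (`a = 0`, `b = 1`, `c = 2`), initial state `0` and final state `1`. -/
def D8 (n : ℕ) (hn : 6 ≤ n) : DFA (Fin 3) (Fin n) where
  step := fun q x => if x = 0 then aD n hn q else if x = 1 then bD n hn q else cD n hn q
  start := ⟨0, by omega⟩
  accept := {⟨1, by omega⟩}

/-- The permutational dialect `D_n(b,c,a)`: letter `b` induces the transformation of
`a`, letter `c` that of `b`, and letter `a` that of `c`. -/
def D8' (n : ℕ) (hn : 6 ≤ n) : DFA (Fin 3) (Fin n) where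
  step := fun q x => if x = 0 then cD n hn q else if x = 1 then aD n hn q else bD n hn q
  start := ⟨0, by omega⟩
  accept := {⟨1, by omega⟩}

def aN (n q : ℕ) : ℕ := if q = 0 then n - 1 else if q = 1 then 2 else if q = 2 then 3
  else if q = 3 then 1 else if q = n - 2 then 4 else if q = n - 1 then q else q + 1

def bN (n q : ℕ) : ℕ := if q = 0 then 1 else if q = 1 then 2 else if q = 2 then n - 1
  else if q = 3 then 4 else if q = 4 then 3 else q

def cN (n q : ℕ) : ℕ := if q = 0 then n - 1 else if q = n - 2 then 1
  else if q = n - 1 then q else q + 1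

def s1 (n q : ℕ) (x : Fin 3) : ℕ := if x = 0 then aN n q else if x = 1 then bN n q else cN n q
def s2 (n q : ℕ) (x : Fin 3) : ℕ := if x = 0 then cN n q else if x = 1 then aN n q else bN n q
def E1 (n q : ℕ) (w : List (Fin 3)) : ℕ := w.foldl (s1 n) q
def E2 (n q : ℕ) (w : List (Fin 3)) : ℕ := w.foldl (s2 n) q

lemma aD_val (n hn q) : (aD n hn q).val = aN n q.val := by
  unfold aD aN; split_ifs <;> rfl
lemma bD_val (n hn q) : (bD n hn q).val = bN n q.val := by
  unfold bD bN; split_ifs <;> rfl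
lemma cD_val (n hn q) : (cD n hn q).val = cN n q.val := by
  unfold cD cN; split_ifs <;> rfl

lemma E1_append (n q : ℕ) (u v : List (Fin 3)) : E1 n q (u ++ v) = E1 n (E1 n q u) v := by
  simp [E1]
lemma E2_append (n q : ℕ) (u v : List (Fin 3)) : E2 n q (u ++ v) = E2 n (E2 n q u) v := by
  simp [E2]

lemma D8_val (n hn) (w : List (Fin 3)) : ∀ q, ((D8 n hn).evalFrom q w).val = E1 n q.val w := by
  induction w with
  | nil => intro q; rfl
  | cons x w ih =>
    intro q
    rw [DFA.evalFrom_cons, ih]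
    have : ((D8 n hn).step q x).val = s1 n q.val x := by
      simp only [D8, s1]
      split_ifs
      · exact aD_val _ _ _
      · exact bD_val _ _ _
      · exact cD_val _ _ _
    rw [this]; rfl

lemma D8'_val (n hn) (w : List (Fin 3)) : ∀ q, ((D8' n hn).evalFrom q w).val = E2 n q.val w := by
  induction w with
  | nil => intro q; rfl
  | cons x w ih =>
    intro q
    rw [DFA.evalFrom_cons, ih]
    have : ((D8' n hn).step q x).val = s2 n q.val x := by
      simp only [D8', s2]
      split_ifs
      · exact cD_val _ _ _
      · exact aD_val _ _ _
      · exact bD_val _ _ _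
    rw [this]; rfl

lemma mem_acc1 (n hn w) : w ∈ acceptsSet (D8 n hn) ↔ E1 n 0 w = 1 := by
  have h := D8_val n hn w (D8 n hn).start
  have h0 : (D8 n hn).start.val = 0 := rfl
  rw [h0] at h
  rw [← h]
  simp only [acceptsSet, Set.mem_setOf_eq]
  change _ = _ ↔ _
  exact Fin.ext_iff

lemma mem_acc2 (n hn w) : w ∈ acceptsSet (D8' n hn) ↔ E2 n 0 w = 1 := by
  have h := D8'_val n hn w (D8' n hn).start
  have h0 : (D8' n hn).start.val = 0 := rfl
  rw [h0] at h
  rw [← h]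
  simp only [acceptsSet, Set.mem_setOf_eq]
  change _ = _ ↔ _
  exact Fin.ext_iff

lemma s1_range (n q : ℕ) (hn : 6 ≤ n) (hq : q ≤ n - 1) (x) : 1 ≤ s1 n q x ∧ s1 n q x ≤ n - 1 := by
  unfold s1 aN bN cN; split_ifs <;> omega
lemma s2_range (n q : ℕ) (hn : 6 ≤ n) (hq : q ≤ n - 1) (x) : 1 ≤ s2 n q x ∧ s2 n q x ≤ n - 1 := by
  unfold s2 aN bN cN; split_ifs <;> omega
lemma s2_sink (n : ℕ) (hn : 6 ≤ n) (x) : s2 n (n - 1) x = n - 1 := by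
  unfold s2 aN bN cN; split_ifs <;> omega
lemma s1_sink (n : ℕ) (hn : 6 ≤ n) (x) : s1 n (n - 1) x = n - 1 := by
  unfold s1 aN bN cN; split_ifs <;> omega

lemma E2_range (n : ℕ) (hn : 6 ≤ n) (w) : ∀ q ≤ n - 1, E2 n q w ≤ n - 1 ∧ (w ≠ [] → 1 ≤ E2 n q w) := by
  induction w using List.reverseRecOn with
  | nil => intro q hq; simpa [E2] using hq
  | append_singleton w x ih =>
    intro q hq
    rw [E2_append]
    have := s2_range n _ hn (ih q hq).1 x
    exact ⟨this.2, fun _ => this.1⟩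
lemma E1_range (n : ℕ) (hn : 6 ≤ n) (w) : ∀ q ≤ n - 1, E1 n q w ≤ n - 1 ∧ (w ≠ [] → 1 ≤ E1 n q w) := by
  induction w using List.reverseRecOn with
  | nil => intro q hq; simpa [E1] using hq
  | append_singleton w x ih =>
    intro q hq
    rw [E1_append]
    have := s1_range n _ hn (ih q hq).1 x
    exact ⟨this.2, fun _ => this.1⟩
lemma E2_sink (n : ℕ) (hn : 6 ≤ n) (w) : E2 n (n - 1) w = n - 1 := by
  induction w with
  | nil => rfl
  | cons x w ih =>
    change E2 n (s2 n (n-1) x) w = _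
    rw [s2_sink n hn, ih]
lemma E1_sink (n : ℕ) (hn : 6 ≤ n) (w) : E1 n (n - 1) w = n - 1 := by
  induction w with
  | nil => rfl
  | cons x w ih =>
    change E1 n (s1 n (n-1) x) w = _
    rw [s1_sink n hn, ih]

open Classical in
noncomputable def core (m n : ℕ) (w : List (Fin 3)) : Finset ℕ :=
  (Finset.Icc 1 (n - 2)).filter
    (fun q => ∃ u v, w = u ++ v ∧ E1 m 0 u = 1 ∧ E2 n 0 v = q)

def Lg (m n : ℕ) (P : ℕ × Finset ℕ) : Set (List (Fin 3)) :=
  {x | (∃ q ∈ P.2, E2 n q x = 1) ∨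
    ∃ x1 x2, x = x1 ++ x2 ∧ E1 m P.1 x1 = 1 ∧ E2 n 0 x2 = 1}

lemma mem_core (m n w q) : q ∈ core m n w ↔
    (1 ≤ q ∧ q ≤ n - 2) ∧ ∃ u v, w = u ++ v ∧ E1 m 0 u = 1 ∧ E2 n 0 v = q := by
  simp [core]

lemma quot_eq (m n hm hn w) :
    leftQuot w (catLang (acceptsSet (D8 m hm)) (acceptsSet (D8' n hn))) =
      Lg m n (E1 m 0 w, core m n w) := by
  ext x
  simp only [leftQuot, catLang, Lg, Set.mem_setOf_eq, mem_acc1, mem_acc2, mem_core]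
  constructor
  · rintro ⟨u, hu, v, hv, h⟩
    rw [List.append_eq_append_iff] at h
    rcases h with ⟨x1, rfl, rfl⟩ | ⟨v', rfl, rfl⟩
    · right
      exact ⟨x1, v, rfl, by rw [← E1_append]; exact hu, hv⟩
    · rw [E2_append] at hv
      by_cases h0 : v' = []
      · subst h0
        right
        exact ⟨[], x, rfl, by simpa [E1] using hu, hv⟩
      · left
        have h1 := E2_range n hn v' 0 (by omega)
        refine ⟨E2 n 0 v', ⟨⟨h1.2 h0, ?_⟩, u, v', rfl, hu, rfl⟩, hv⟩
        by_contra hc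
        have : E2 n 0 v' = n - 1 := by omega
        rw [this, E2_sink n hn] at hv
        omega
  · rintro (⟨q, ⟨_, u, v, rfl, hu, rfl⟩, hq⟩ | ⟨x1, x2, rfl, h1, h2⟩)
    · exact ⟨u, hu, v ++ x, by rw [E2_append]; exact hq, by simp⟩
    · exact ⟨w ++ x1, by rw [E1_append]; exact h1, x2, h2, by simp⟩

lemma core_step (m n w x q') : q' ∈ core m n (w ++ [x]) ↔ (1 ≤ q' ∧ q' ≤ n - 2) ∧
    ((∃ v u, w = u ++ v ∧ E1 m 0 u = 1 ∧ s2 n (E2 n 0 v) x = q')) := by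
  rw [mem_core]
  constructor
  · rintro ⟨h, u, v, e, hu, hv⟩
    refine ⟨h, ?_⟩
    rcases List.eq_nil_or_concat v with rfl | ⟨v, y, rfl⟩
    · simp [E2] at hv; omega
    · rw [List.concat_eq_append] at e hv
      rw [← List.append_assoc] at e
      obtain ⟨rfl, e2⟩ := List.append_inj' e rfl
      obtain rfl : x = y := by simpa using e2
      rw [E2_append] at hv
      exact ⟨v, u, rfl, hu, hv⟩
  · rintro ⟨h, v, u, rfl, hu, hv⟩
    exact ⟨h, u, v ++ [x], by simp, hu, by rw [E2_append]; exact hv⟩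

def Reach (m n p : ℕ) (U : Finset ℕ) : Prop := ∃ w, E1 m 0 w = p ∧ core m n w = U

def pb (n : ℕ) (f : ℕ → ℕ) (U : Finset ℕ) : Finset ℕ :=
  (Finset.Icc 1 (n - 2)).filter (fun q => f q ∈ U)

lemma mem_pb (n f U q) : q ∈ pb n f U ↔ (1 ≤ q ∧ q ≤ n - 2) ∧ f q ∈ U := by simp [pb]

lemma pb_sub (n f U) : pb n f U ⊆ Finset.Icc 1 (n - 2) := Finset.filter_subset _ _

lemma step_gen (m n : ℕ) (hn : 6 ≤ n) (p x) (U : Finset ℕ) (hU : U ⊆ Finset.Icc 1 (n - 2))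
    (h1 : ∀ q' ∈ U, (∃ q, (1 ≤ q ∧ q ≤ n - 2) ∧ s2 n q x = q') ∨ (p = 1 ∧ s2 n 0 x = q'))
    (h2 : p = 1 → s2 n 0 x ≤ n - 2 → s2 n 0 x ∈ U)
    (hR : Reach m n p (pb n (fun q => s2 n q x) U)) : Reach m n (s1 m p x) U := by
  obtain ⟨w, hw, hc⟩ := hR
  refine ⟨w ++ [x], by rw [E1_append, hw]; rfl, ?_⟩
  ext q'
  rw [core_step]
  constructor
  · rintro ⟨hq', v, u, e, hu, hv⟩
    by_cases h0 : v = []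
    · subst h0
      simp only [List.append_nil] at e
      subst e
      have : p = 1 := by omega
      change s2 n 0 x = q' at hv
      rw [← hv]
      exact h2 this (by omega)
    · have hr := E2_range n hn v 0 (by omega)
      by_cases hl : E2 n 0 v = n - 1
      · rw [hl, s2_sink n hn] at hv; omega
      · have : E2 n 0 v ∈ core m n w := by
          rw [mem_core]
          exact ⟨⟨hr.2 h0, by omega⟩, u, v, e, hu, rfl⟩
        rw [hc, mem_pb] at this
        rw [← hv]; exact this.2
  · intro hq'
    refine ⟨by simpa using hU hq', ?_⟩
    rcases h1 q' hq' with ⟨q, hq, e⟩ | ⟨hp, e⟩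
    · have : q ∈ core m n w := by
        rw [hc, mem_pb]; exact ⟨hq, by simpa [e] using hq'⟩
      rw [mem_core] at this
      obtain ⟨_, u, v, e1, hu, rfl⟩ := this
      exact ⟨v, u, e1, hu, e⟩
    · exact ⟨[], w, by simp, by omega, e⟩

lemma surjA (n : ℕ) (hn : 6 ≤ n) (q' : ℕ) (h : 1 ≤ q' ∧ q' ≤ n - 2) :
    ∃ q, (1 ≤ q ∧ q ≤ n - 2) ∧ aN n q = q' := by
  refine ⟨if q' = 1 then 3 else if q' = 4 then n - 2 else q' - 1, ?_⟩
  unfold aN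
  grind
lemma surjC (n : ℕ) (hn : 6 ≤ n) (q' : ℕ) (h : 1 ≤ q' ∧ q' ≤ n - 2) :
    ∃ q, (1 ≤ q ∧ q ≤ n - 2) ∧ cN n q = q' := by
  refine ⟨if q' = 1 then n - 2 else q' - 1, ?_⟩
  unfold cN
  grind
lemma surjB (n : ℕ) (hn : 6 ≤ n) (q' : ℕ) (h : 2 ≤ q' ∧ q' ≤ n - 2) :
    ∃ q, (1 ≤ q ∧ q ≤ n - 2) ∧ bN n q = q' := by
  refine ⟨if q' = 2 then 1 else if q' = 3 then 4 else if q' = 4 then 3 else q', ?_⟩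
  unfold bN
  grind

lemma stepA (m n : ℕ) (hn : 6 ≤ n) (p p' : ℕ) (U : Finset ℕ) (hU : U ⊆ Finset.Icc 1 (n - 2))
    (hp : aN m p = p') (hR : Reach m n p (pb n (cN n) U)) : Reach m n p' U := by
  subst hp
  refine step_gen m n hn p 0 U hU (fun q' hq' => Or.inl ?_) ?_ hR
  · exact surjC n hn q' (by simpa using hU hq')
  · intro _ h; exfalso; simp [s2, cN] at h; omega
lemma stepB (m n : ℕ) (hn : 6 ≤ n) (p p' : ℕ) (U : Finset ℕ) (hU : U ⊆ Finset.Icc 1 (n - 2))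
    (hp : bN m p = p') (hR : Reach m n p (pb n (aN n) U)) : Reach m n p' U := by
  subst hp
  refine step_gen m n hn p 1 U hU (fun q' hq' => Or.inl ?_) ?_ hR
  · exact surjA n hn q' (by simpa using hU hq')
  · intro _ h; exfalso; simp [s2, aN] at h; omega
lemma stepC (m n : ℕ) (hn : 6 ≤ n) (p' : ℕ) (U : Finset ℕ) (hU : U ⊆ Finset.Icc 1 (n - 2))
    (hp : cN m 1 = p') (h1 : 1 ∈ U) (hR : Reach m n 1 (pb n (bN n) U)) : Reach m n p' U := by
  subst hp
  refine step_gen m n hn 1 2 U hU (fun q' hq' => ?_) (fun _ _ => h1) hR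
  by_cases h : q' = 1
  · right; subst h; exact ⟨rfl, rfl⟩
  · left
    have : 1 ≤ q' ∧ q' ≤ n - 2 := by simpa using hU hq'
    exact surjB n hn q' (by omega)

lemma cardA (n : ℕ) (hn : 6 ≤ n) (U : Finset ℕ) : (pb n (aN n) U).card ≤ U.card := by
  apply Finset.card_le_card_of_injOn (aN n)
  · intro q hq; exact ((mem_pb _ _ _ _).1 hq).2
  · intro q hq r hr h
    have hq := ((mem_pb _ _ _ _).1 hq).1
    have hr := ((mem_pb _ _ _ _).1 hr).1
    unfold aN at h; split_ifs at h <;> omega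
lemma cardC (n : ℕ) (hn : 6 ≤ n) (U : Finset ℕ) : (pb n (cN n) U).card ≤ U.card := by
  apply Finset.card_le_card_of_injOn (cN n)
  · intro q hq; exact ((mem_pb _ _ _ _).1 hq).2
  · intro q hq r hr h
    have hq := ((mem_pb _ _ _ _).1 hq).1
    have hr := ((mem_pb _ _ _ _).1 hr).1
    unfold cN at h; split_ifs at h <;> omega
lemma cardB (n : ℕ) (hn : 6 ≤ n) (U : Finset ℕ) (h1 : 1 ∈ U) :
    (pb n (bN n) U).card < U.card := by
  refine lt_of_le_of_lt ?_ (Finset.card_erase_lt_of_mem h1)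
  apply Finset.card_le_card_of_injOn (bN n)
  · intro q hq
    have hq := (mem_pb _ _ _ _).1 hq
    refine Finset.mem_coe.2 (Finset.mem_erase.2 ⟨?_, hq.2⟩)
    unfold bN; grind
  · intro q hq r hr h
    have hq := ((mem_pb _ _ _ _).1 hq).1
    have hr := ((mem_pb _ _ _ _).1 hr).1
    unfold bN at h; split_ifs at h <;> omega

lemma fill (m n : ℕ) (hm : 6 ≤ m) (hn : 6 ≤ n) (k : ℕ)
    (H : ∀ U ⊆ Finset.Icc 1 (n - 2), U.card ≤ k → Reach m n 3 U) :
    ∀ p, 1 ≤ p → p ≤ m - 2 → ∀ U ⊆ Finset.Icc 1 (n - 2), U.card ≤ k → Reach m n p U := by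
  have H1 : ∀ U ⊆ Finset.Icc 1 (n - 2), U.card ≤ k → Reach m n 1 U := fun U hU hk =>
    stepA m n hn 3 1 U hU (by simp [aN]) (H _ (pb_sub _ _ _) ((cardC n hn U).trans hk))
  have H2 : ∀ U ⊆ Finset.Icc 1 (n - 2), U.card ≤ k → Reach m n 2 U := fun U hU hk =>
    stepA m n hn 1 2 U hU (by simp [aN]) (H1 _ (pb_sub _ _ _) ((cardC n hn U).trans hk))
  intro p
  induction p with
  | zero => intro h; omega
  | succ p ih =>
    intro _ hp U hU hk
    by_cases h1 : p = 0
    · subst h1; exact H1 U hU hk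
    by_cases h2 : p = 1
    · subst h2; exact H2 U hU hk
    by_cases h3 : p = 2
    · subst h3; exact H U hU hk
    by_cases h4 : p = 3
    · subst h4
      exact stepB m n hn 3 4 U hU (by simp [bN]) (H _ (pb_sub _ _ _) ((cardA n hn U).trans hk))
    · exact stepA m n hn p (p + 1) U hU (by unfold aN; grind)
        (ih (by omega) (by omega) _ (pb_sub _ _ _) ((cardC n hn U).trans hk))

lemma pb_empty (n f) : pb n f ∅ = ∅ := by simp [pb]

lemma reach1 (m n : ℕ) (hn : 6 ≤ n) : Reach m n 1 ∅ := by
  refine ⟨[] ++ [1], by simp [E1, s1, bN], ?_⟩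
  ext q'
  rw [core_step]
  simp only [Finset.notMem_empty, iff_false]
  rintro ⟨_, v, u, e, hu, hv⟩
  obtain ⟨rfl, rfl⟩ := List.append_eq_nil_iff.1 e.symm
  simp [E1] at hu

lemma reach3e (m n : ℕ) (hn : 6 ≤ n) : Reach m n 3 ∅ := by
  refine stepA m n hn 2 3 ∅ (by simp) (by simp [aN]) ?_
  rw [pb_empty]
  refine stepA m n hn 1 2 ∅ (by simp) (by simp [aN]) ?_
  rw [pb_empty]
  exact reach1 m n hn

lemma reach3 (m n : ℕ) (hm : 6 ≤ m) (hn : 6 ≤ n) (k : ℕ) :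
    ∀ U ⊆ Finset.Icc 1 (n - 2), U.card ≤ k → Reach m n 3 U := by
  induction k with
  | zero =>
    intro U _ hk
    obtain rfl : U = ∅ := by simpa using hk
    exact reach3e m n hn
  | succ k ih =>
    have F := fill m n hm hn k ih
    have h2 : ∀ U ⊆ Finset.Icc 1 (n - 2), U.card ≤ k + 1 → 2 ∈ U → Reach m n 3 U := by
      intro U hU hk h
      refine stepA m n hn 2 3 U hU (by simp [aN]) ?_
      have h1 : 1 ∈ pb n (cN n) U := by
        rw [mem_pb]
        refine ⟨by omega, ?_⟩
        have : cN n 1 = 2 := by unfold cN; grind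
        rwa [this]
      refine stepC m n hn 2 _ (pb_sub _ _ _) (by unfold cN; grind) h1 ?_
      refine F 1 le_rfl (by omega) _ (pb_sub _ _ _) ?_
      have := cardB n hn _ h1
      have := cardC n hn U
      omega
    have hb : ∀ U ⊆ Finset.Icc 1 (n - 2), Reach m n 3 (pb n (aN n) (pb n (aN n) U)) →
        Reach m n 3 U := by
      intro U hU h
      refine stepB m n hn 4 3 U hU (by simp [bN]) ?_
      exact stepB m n hn 3 4 _ (pb_sub _ _ _) (by simp [bN]) h
    have h1 : ∀ U ⊆ Finset.Icc 1 (n - 2), U.card ≤ k + 1 → 1 ∈ U → Reach m n 3 U := by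
      intro U hU hk h
      refine hb U hU (h2 _ (pb_sub _ _ _) ?_ ?_)
      · exact (cardA n hn _).trans ((cardA n hn _).trans hk)
      · simp only [mem_pb]
        simp [aN]
        exact ⟨by omega, by omega, h⟩
    have h3 : ∀ U ⊆ Finset.Icc 1 (n - 2), U.card ≤ k + 1 → 3 ∈ U → Reach m n 3 U := by
      intro U hU hk h
      refine hb U hU (h1 _ (pb_sub _ _ _) ?_ ?_)
      · exact (cardA n hn _).trans ((cardA n hn _).trans hk)
      · simp only [mem_pb]
        simp [aN]
        exact ⟨by omega, by omega, h⟩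
    have hx : ∀ x, ∀ U ⊆ Finset.Icc 1 (n - 2), U.card ≤ k + 1 → x ∈ U → Reach m n 3 U := by
      intro x
      induction x using Nat.strong_induction_on with
      | _ x IH =>
        intro U hU hk h
        have hr : 1 ≤ x ∧ x ≤ n - 2 := by simpa using hU h
        by_cases e1 : x = 1
        · subst e1; exact h1 U hU hk h
        by_cases e2 : x = 2
        · subst e2; exact h2 U hU hk h
        by_cases e3 : x = 3
        · subst e3; exact h3 U hU hk h
        refine stepA m n hn 2 3 U hU (by simp [aN]) ?_
        refine stepA m n hn 1 2 _ (pb_sub _ _ _) (by simp [aN]) ?_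
        refine stepA m n hn 3 1 _ (pb_sub _ _ _) (by simp [aN]) ?_
        refine IH (x - 3) (by omega) _ (pb_sub _ _ _) ?_ ?_
        · exact (cardC n hn _).trans ((cardC n hn _).trans ((cardC n hn _).trans hk))
        · have c1 : cN n (x - 3) = x - 2 := by unfold cN; grind
          have c2 : cN n (x - 2) = x - 1 := by unfold cN; grind
          have c3 : cN n (x - 1) = x := by unfold cN; grind
          simp only [mem_pb, c1, c2, c3]
          exact ⟨by omega, by omega, by omega, h⟩
    intro U hU hk
    rcases U.eq_empty_or_nonempty with rfl | ⟨x, h⟩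
    · exact reach3e m n hn
    · exact hx x U hU hk h

lemma reach_all (m n : ℕ) (hm : 6 ≤ m) (hn : 6 ≤ n) (p : ℕ) (h1 : 1 ≤ p) (h2 : p ≤ m - 1)
    (U : Finset ℕ) (hU : U ⊆ Finset.Icc 1 (n - 2)) : Reach m n p U := by
  by_cases h : p = m - 1
  · refine stepB m n hn 2 p U hU (by simp [bN, h]) ?_
    exact fill m n hm hn _ (reach3 m n hm hn _) 2 (by omega) (by omega) _ (pb_sub _ _ _) le_rfl
  · exact fill m n hm hn _ (reach3 m n hm hn _) p (by omega) (by omega) _ hU le_rfl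

def Idx (m n : ℕ) : Finset (ℕ × Finset ℕ) :=
  insert (0, ∅) (Finset.Icc 1 (m - 1) ×ˢ (Finset.Icc 1 (n - 2)).powerset)

lemma card_Idx (m n : ℕ) : (Idx m n).card = (m - 1) * 2 ^ (n - 2) + 1 := by
  rw [Idx, Finset.card_insert_of_notMem (by simp)]
  simp

lemma core_nil (m n : ℕ) : core m n [] = ∅ := by
  ext q
  rw [mem_core]
  simp only [Finset.notMem_empty, iff_false]
  rintro ⟨_, u, v, e, hu, hv⟩
  obtain ⟨rfl, rfl⟩ := List.append_eq_nil_iff.1 e.symm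
  simp [E1] at hu

lemma quots (m n hm hn) :
    {K | ∃ w, K = leftQuot w (catLang (acceptsSet (D8 m hm)) (acceptsSet (D8' n hn)))} =
      Lg m n '' (Idx m n : Set (ℕ × Finset ℕ)) := by
  ext K
  simp only [Set.mem_setOf_eq, Set.mem_image, Finset.mem_coe, quot_eq]
  constructor
  · rintro ⟨w, rfl⟩
    refine ⟨_, ?_, rfl⟩
    by_cases h : w = []
    · subst h; rw [core_nil]; simp [Idx, E1]
    · have := E1_range m hm w 0 (by omega)
      simp only [Idx, Finset.mem_insert, Finset.mem_product, Finset.mem_Icc,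
        Finset.mem_powerset]
      exact Or.inr ⟨⟨this.2 h, this.1⟩, fun q hq => Finset.mem_Icc.2 ((mem_core _ _ _ _).1 hq).1⟩
  · rintro ⟨⟨p, U⟩, h, rfl⟩
    simp only [Idx, Finset.mem_insert, Finset.mem_product, Finset.mem_Icc,
        Finset.mem_powerset] at h
    rcases h with h | ⟨⟨ha, hb⟩, hc⟩
    · refine ⟨[], ?_⟩
      rw [core_nil, h]; rfl
    · obtain ⟨w, rfl, rfl⟩ := reach_all m n hm hn p ha hb U hc
      exact ⟨w, rfl⟩

lemma cyc_rep (n : ℕ) (hn : 6 ≤ n) (j : ℕ) : ∀ r, 1 ≤ r → r ≤ n - 2 → j ≤ n - 2 →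
    (cN n)^[j] r = if r + j ≤ n - 2 then r + j else r + j - (n - 2) := by
  induction j with
  | zero => intro r h1 h2 h3; simp [h2]
  | succ j ih =>
    intro r h1 h2 h3
    rw [Function.iterate_succ_apply', ih r h1 h2 (by omega)]
    unfold cN
    split_ifs <;> omega

lemma E2_it (n j : ℕ) : ∀ r, E2 n r (List.replicate j 0) = (cN n)^[j] r := by
  induction j with
  | zero => intro r; rfl
  | succ j ih => intro r; rw [Function.iterate_succ_apply, ← ih]; rfl

lemma E1_it (n j : ℕ) : ∀ r, E1 n r (List.replicate j 2) = (cN n)^[j] r := by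
  induction j with
  | zero => intro r; rfl
  | succ j ih => intro r; rw [Function.iterate_succ_apply, ← ih]; rfl

-- distinguishing
lemma E2_rep (n : ℕ) (hn : 6 ≤ n) (j : ℕ) : ∀ q r, 1 ≤ q → q ≤ n - 2 → q + j = n - 1 →
    1 ≤ r → r ≤ n - 2 → (E2 n r (List.replicate j 0) = 1 ↔ r = q) := by
  intro q r h1 h2 h3 h4 h5
  rw [E2_it, cyc_rep n hn j r h4 h5 (by omega)]
  split_ifs <;> omega

lemma E2_rep0 (n : ℕ) (hn : 6 ≤ n) (j : ℕ) : E2 n 0 (List.replicate j 0) ≠ 1 := by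
  cases j with
  | zero => simp [E2]
  | succ j =>
    rw [List.replicate_succ]
    change E2 n (cN n 0) _ ≠ 1
    have : cN n 0 = n - 1 := by simp [cN]
    rw [this, E2_sink n hn]; omega

lemma Lg_rep (m n : ℕ) (hn : 6 ≤ n) (p : ℕ) (U : Finset ℕ) (hU : U ⊆ Finset.Icc 1 (n - 2))
    (q : ℕ) (h1 : 1 ≤ q) (h2 : q ≤ n - 2) :
    List.replicate (n - 1 - q) 0 ∈ Lg m n (p, U) ↔ q ∈ U := by
  simp only [Lg, Set.mem_setOf_eq]
  constructor
  · rintro (⟨r, hr, h⟩ | ⟨x1, x2, e, _, h⟩)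
    · have : 1 ≤ r ∧ r ≤ n - 2 := by simpa using hU hr
      rw [E2_rep n hn _ q r h1 h2 (by omega) this.1 this.2] at h
      exact h ▸ hr
    · have := (List.append_eq_replicate_iff.1 e.symm).2.2
      rw [this] at h
      exact absurd h (E2_rep0 n hn _)
  · intro h
    exact Or.inl ⟨q, h, (E2_rep n hn _ q q h1 h2 (by omega) h1 h2).2 rfl⟩

lemma bN_one (n q : ℕ) (hn : 6 ≤ n) : bN n q = 1 → q = 0 := by
  unfold bN; grind

lemma Lg_c (m n : ℕ) (hn : 6 ≤ n) (p : ℕ) (U : Finset ℕ) (hU : U ⊆ Finset.Icc 1 (n - 2))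
    (x : List (Fin 3)) : x ++ [2] ∈ Lg m n (p, U) ↔ E1 m p x = 1 := by
  have key : ∀ q ≤ n - 1, ∀ y, E2 n q (y ++ [2]) = 1 → y = [] ∧ q = 0 := by
    intro q hq y h
    rw [E2_append] at h
    have h0 := bN_one n _ hn h
    have := E2_range n hn y q hq
    have hy : y = [] := by by_contra hc; have := this.2 hc; omega
    subst hy
    exact ⟨rfl, h0⟩
  simp only [Lg, Set.mem_setOf_eq]
  constructor
  · rintro (⟨q, hq, h⟩ | ⟨x1, x2, e, h1, h2⟩)
    · have : 1 ≤ q ∧ q ≤ n - 2 := by simpa using hU hq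
      have := key q (by omega) _ h
      omega
    · rcases List.eq_nil_or_concat x2 with rfl | ⟨v, y, rfl⟩
      · simp [E2] at h2
      · rw [List.concat_eq_append] at e h2
        rw [← List.append_assoc] at e
        obtain ⟨rfl, e2⟩ := List.append_inj' e rfl
        obtain rfl : 2 = y := by simpa using e2
        obtain ⟨rfl, _⟩ := key 0 (by omega) _ h2
        simpa using h1
  · intro h
    exact Or.inr ⟨x, [2], rfl, h, rfl⟩

lemma E1_rep (n : ℕ) (hn : 6 ≤ n) (j : ℕ) : ∀ q r, 1 ≤ q → q ≤ n - 2 → q + j = n - 1 →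
    1 ≤ r → r ≤ n - 2 → (E1 n r (List.replicate j 2) = 1 ↔ r = q) := by
  intro q r h1 h2 h3 h4 h5
  rw [E1_it, cyc_rep n hn j r h4 h5 (by omega)]
  split_ifs <;> omega

lemma dist1 (m : ℕ) (hm : 6 ≤ m) (p p' : ℕ) (h' : p' ≤ m - 1) (hlt : p < p') :
    ∃ x, E1 m p x = 1 ∧ E1 m p' x ≠ 1 := by
  by_cases h0 : p = 0
  · subst h0
    refine ⟨[1], rfl, fun h => ?_⟩
    have := bN_one m p' hm h
    omega
  · refine ⟨List.replicate (m - 1 - p) 2, ?_, ?_⟩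
    · exact (E1_rep m hm _ p p (by omega) (by omega) (by omega) (by omega) (by omega)).2 rfl
    · by_cases he : p' = m - 1
      · rw [he, E1_sink m hm]; omega
      · rw [Ne, E1_rep m hm _ p p' (by omega) (by omega) (by omega) (by omega) (by omega)]
        omega

lemma inj (m n : ℕ) (hm : 6 ≤ m) (hn : 6 ≤ n) :
    Set.InjOn (Lg m n) (Idx m n : Set (ℕ × Finset ℕ)) := by
  have hI : ∀ p U, (p, U) ∈ Idx m n → p ≤ m - 1 ∧ U ⊆ Finset.Icc 1 (n - 2) := by
    intro p U h
    simp only [Idx, Finset.mem_insert, Finset.mem_product, Finset.mem_Icc,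
        Finset.mem_powerset, Prod.mk.injEq] at h
    rcases h with ⟨rfl, rfl⟩ | h
    · simp
    · exact ⟨h.1.2, h.2⟩
  rintro ⟨p, U⟩ h ⟨p', U'⟩ h' e
  obtain ⟨hp, hU⟩ := hI p U h
  obtain ⟨hp', hU'⟩ := hI p' U' h'
  have e1 : U = U' := by
    ext q
    by_cases hq : 1 ≤ q ∧ q ≤ n - 2
    · rw [← Lg_rep m n hn p U hU q hq.1 hq.2, e, Lg_rep m n hn p' U' hU' q hq.1 hq.2]
    · constructor
      · intro hh; exact absurd (by simpa using hU hh) hq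
      · intro hh; exact absurd (by simpa using hU' hh) hq
  have e2 : ∀ x, E1 m p x = 1 ↔ E1 m p' x = 1 := by
    intro x
    rw [← Lg_c m n hn p U hU, e, Lg_c m n hn p' U' hU']
  have e3 : p = p' := by
    rcases lt_trichotomy p p' with hl | hl | hl
    · obtain ⟨x, ha, hb⟩ := dist1 m hm p p' hp' hl
      exact absurd ((e2 x).1 ha) hb
    · exact hl
    · obtain ⟨x, ha, hb⟩ := dist1 m hm p' p hp hl
      exact absurd ((e2 x).2 ha) hb
  rw [e1, e3]

/-- For `m, n ≥ 6`, the product `L_m(a,b,c) · L_n(b,c,a)` meets the bound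
`(m−1)·2^{n−2} + 1` for the product of suffix-free languages. -/
theorem stmt8 (m n : ℕ) (hm : 6 ≤ m) (hn : 6 ≤ n) :
    quotComp (catLang (acceptsSet (D8 m hm)) (acceptsSet (D8' n hn))) =
      (m - 1) * 2 ^ (n - 2) + 1 := by
  rw [quotComp, quots, Set.ncard_image_of_injOn (inj m n hm hn), Set.ncard_coe_finset, card_Idx]
end

section
/- Suppose m, n ≥ 4 and K, L are suffix-free regular languages with κ(K) = m and κ(L) = n such that the product meets the bound, i.e., κ(K·L) = (m−1)·2^{n−2} + 1. Then the transition semigroup T_n of the minimal DFA D = (Q_n, Σ, δ, 0, F) of L (with initial state 0 and empty state n−1) is contained in Vsf(n) and is not contained in Wsf(n). -/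
theorem aux_full {α : Type} (m n : ℕ) (hm : 4 ≤ m) (hn : 4 ≤ n)
    (K L : Set (List α)) (hsfK : SuffixFree K)
    (hqK : quotComp K = m)
    (hprod : quotComp (catLang K L) = (m - 1) * 2 ^ (n - 2) + 1)
    (M : DFA α (Fin n)) (hacc : acceptsSet M = L)
    (hempty : stateLang M ⟨n - 1, by omega⟩ = ∅)
    (h0 : ∀ v : List α, v ≠ [] → (M.evalFrom M.start v).val ≠ 0) :
    ∃ w : List α, ∀ q : Fin n, 0 < q.val → q.val < n - 1 →
      ∃ u v, w = u ++ v ∧ u ∈ K ∧ M.evalFrom M.start v = q := by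
  classical
  by_contra hcon
  push Not at hcon
  let mid : Finset (Fin n) := Finset.univ.filter (fun q => 0 < q.val ∧ q.val < n - 1)
  have hmid : mid.card = n - 2 := by
    have : mid = Finset.Ioo (⟨0, by omega⟩ : Fin n) ⟨n - 1, by omega⟩ := by
      ext q
      simp [mid, Fin.lt_def]
    rw [this, Fin.card_Ioo]
    simp
    omega
  let QK : Set (Set (List α)) := {X | ∃ w : List α, X = leftQuot w K}
  have hQK : QK.ncard = m := hqK
  have hfin : QK.Finite := Set.finite_of_ncard_pos (by omega)
  have hKmem : K ∈ QK := ⟨[], by simp [leftQuot]⟩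
  have hKne : K.Nonempty := by
    by_contra hne
    rw [Set.not_nonempty_iff_eq_empty] at hne
    have : QK ⊆ {∅} := by
      rintro X ⟨w, rfl⟩
      simp [leftQuot, hne]
    have := Set.ncard_le_ncard this
    simp at this
    omega
  let F : Set (List α) × Finset (Fin n) → Set (List α) :=
    fun P => catLang P.1 L ∪ {x | ∃ q ∈ P.2, x ∈ stateLang M q}
  let P : Set (Set (List α) × Finset (Fin n)) :=
    (QK \ {K}) ×ˢ (((mid.powerset).erase mid : Finset (Finset (Fin n))) : Set (Finset (Fin n)))
  have hPfin : P.Finite := (hfin.diff).prod (Finset.finite_toSet _)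
  have hPcard : P.ncard = (m - 1) * (2 ^ (n - 2) - 1) := by
    rw [Set.ncard_prod, Set.ncard_coe_finset, Set.ncard_diff_singleton_of_mem hKmem, hQK,
      Finset.card_erase_of_mem (by simp), Finset.card_powerset, hmid]
  have hsub : {X : Set (List α) | ∃ w : List α, X = leftQuot w (catLang K L)} ⊆
      insert (catLang K L) (F '' P) := by
    rintro X ⟨w, rfl⟩
    by_cases hw : w = []
    · left
      simp [hw, leftQuot]
    right
    let S : Finset (Fin n) :=
      mid.filter (fun q => ∃ u v, w = u ++ v ∧ u ∈ K ∧ M.evalFrom M.start v = q)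
    refine ⟨(leftQuot w K, S), ?_, ?_⟩
    · refine ⟨⟨⟨w, rfl⟩, ?_⟩, ?_⟩
      · intro h
        simp only [Set.mem_singleton_iff] at h
        obtain ⟨x, hx⟩ := hKne
        have hx2 : x ∈ leftQuot w K := by rw [h]; exact hx
        exact hw (hsfK w x hx hx2)
      · simp only [Finset.coe_erase, Set.mem_diff, Finset.mem_coe, Finset.mem_powerset,
          Set.mem_singleton_iff]
        refine ⟨Finset.filter_subset _ _, ?_⟩
        intro h
        obtain ⟨q, hq1, hq2, hq3⟩ := hcon w
        have hq : q ∈ S := by rw [h]; simp [mid, hq1, hq2]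
        obtain ⟨u, v, h1, h2, h3⟩ := (Finset.mem_filter.1 hq).2
        exact hq3 u v h1 h2 h3
    · ext x
      simp only [F]
      constructor
      · rintro (⟨u, hu, v, hv, rfl⟩ | ⟨q, hq, hx⟩)
        · exact ⟨w ++ u, hu, v, hv, by simp⟩
        · obtain ⟨u, v, h1, h2, h3⟩ := (Finset.mem_filter.1 hq).2
          refine ⟨u, h2, v ++ x, ?_, by simp [h1]⟩
          rw [← hacc]
          change M.evalFrom M.start (v ++ x) ∈ M.accept
          rw [DFA.evalFrom_of_append, h3]
          exact hx
      · rintro ⟨u, hu, v, hv, he⟩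
        rcases List.append_eq_append_iff.1 he with ⟨a, h1, h2⟩ | ⟨a, h1, h2⟩
        · left
          exact ⟨a, by rw [h1] at hu; exact hu, v, hv, h2⟩
        · by_cases ha : a = []
          · left
            subst ha
            refine ⟨[], ?_, v, hv, by simpa using h2.symm⟩
            simpa [leftQuot, h1] using hu
          · right
            have hx : x ∈ stateLang M (M.evalFrom M.start a) := by
              rw [← hacc, h2] at hv
              change M.evalFrom M.start (a ++ x) ∈ M.accept at hv
              rw [DFA.evalFrom_of_append] at hv
              exact hv
            refine ⟨M.evalFrom M.start a, ?_, hx⟩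
            refine Finset.mem_filter.2 ⟨?_, u, a, h1, hu, rfl⟩
            have hl : M.evalFrom M.start a ≠ ⟨n - 1, by omega⟩ := by
              intro h
              rw [h, hempty] at hx
              exact hx
            have hz := h0 a ha
            have := (M.evalFrom M.start a).isLt
            simp only [mid, Finset.mem_filter, Finset.mem_univ, true_and]
            rw [Ne, Fin.ext_iff] at hl
            simp only at hl
            omega
  have h1 := Set.ncard_le_ncard hsub ((hPfin.image F).insert _)
  have h2 := Set.ncard_insert_le (catLang K L) (F '' P)
  have h3 := Set.ncard_image_le (f := F) hPfin
  have h4 : quotComp (catLang K L) ≤ (m - 1) * (2 ^ (n - 2) - 1) + 1 := by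
    unfold quotComp
    omega
  rw [hprod] at h4
  have h5 : (m - 1) * (2 ^ (n - 2) - 1) < (m - 1) * 2 ^ (n - 2) := by
    apply Nat.mul_lt_mul_of_pos_left
    · have := Nat.two_pow_pos (n - 2)
      omega
    · omega
  omega

/-- If `K, L` are suffix-free regular languages of quotient complexities `m, n ≥ 4`
whose product meets the bound `(m−1)·2^{n−2} + 1`, then the transition semigroup of
the minimal DFA of `L` (on `Q_n`, initial state `0`, empty state `n−1`) is contained
in `Vsf(n)` and not contained in `Wsf(n)`. -/
theorem stmt10 {α : Type} (m n : ℕ) (hm : 4 ≤ m) (hn : 4 ≤ n)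
    (K L : Set (List α)) (hregK : RegularLang K) (hregL : RegularLang L)
    (hsfK : SuffixFree K) (hsfL : SuffixFree L)
    (hqK : quotComp K = m) (hqL : quotComp L = n)
    (hprod : quotComp (catLang K L) = (m - 1) * 2 ^ (n - 2) + 1)
    (M : DFA α (Fin n)) (hacc : acceptsSet M = L)
    (hstart : M.start = ⟨0, by omega⟩) (hmin : MinimalDFA M)
    (hempty : stateLang M ⟨n - 1, by omega⟩ = ∅) :
    transSemigroup M ⊆ Vsf n (by omega) ∧ ¬ transSemigroup M ⊆ Wsf n (by omega) := by
  have hLiff : ∀ w, w ∈ L ↔ M.evalFrom M.start w ∈ M.accept := by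
    intro w; rw [← hacc]; rfl
  have happ : ∀ v x, v ++ x ∈ L ↔ x ∈ stateLang M (M.evalFrom M.start v) := by
    intro v x; rw [hLiff, DFA.evalFrom_of_append]; rfl
  have hne : ∀ q : Fin n, q ≠ ⟨n - 1, by omega⟩ → ∃ x, x ∈ stateLang M q := by
    intro q hq
    by_contra h
    push Not at h
    apply hq
    apply hmin.2
    rw [hempty]
    exact Set.eq_empty_iff_forall_notMem.2 h
  have h0 : ∀ v : List α, v ≠ [] → (M.evalFrom M.start v).val ≠ 0 := by
    intro v hv h
    obtain ⟨x, hx⟩ := hne ⟨0, by omega⟩ (by simp [Fin.ext_iff]; omega)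
    have he : M.evalFrom M.start v = ⟨0, by omega⟩ := Fin.ext h
    apply hv
    refine hsfL v x ?_ ((happ v x).2 (by rw [he]; exact hx))
    have := (happ [] x).2 (by simpa [hstart] using hx)
    simpa using this
  have hlast : ∀ v, M.evalFrom ⟨n - 1, by omega⟩ v = (⟨n - 1, by omega⟩ : Fin n) := by
    intro v
    by_contra h
    obtain ⟨x, hx⟩ := hne _ h
    have : v ++ x ∈ stateLang M ⟨n - 1, by omega⟩ := by
      change M.evalFrom _ (v ++ x) ∈ M.accept
      rw [DFA.evalFrom_of_append]
      exact hx
    rw [hempty] at this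
    exact this
  -- two words of which one is a suffix of the other cannot meet in a nonempty state
  have hmeet : ∀ u v : List α, u ≠ [] →
      M.evalFrom M.start (u ++ v) = M.evalFrom M.start v →
      M.evalFrom M.start v = ⟨n - 1, by omega⟩ := by
    intro u v hu h
    by_contra hc
    obtain ⟨x, hx⟩ := hne _ hc
    apply hu
    refine hsfL u (v ++ x) ((happ v x).2 hx) ?_
    rw [← List.append_assoc]
    exact (happ _ x).2 (by rw [h]; exact hx)
  have hB0 : ∀ w : List α, ∀ q : Fin n, 0 < q.val →
      M.evalFrom ⟨0, by omega⟩ w = M.evalFrom q w →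
      M.evalFrom (⟨0, by omega⟩ : Fin n) w = ⟨n - 1, by omega⟩ := by
    intro w q hq h
    obtain ⟨u, hu⟩ := hmin.1 q
    have hu0 : u ≠ [] := by
      rintro rfl
      rw [DFA.evalFrom_nil, hstart] at hu
      rw [← hu] at hq
      simp at hq
    have := hmeet u w hu0 (by rw [DFA.evalFrom_of_append, hu, hstart]; exact h.symm)
    rw [hstart] at this
    exact this
  have hiter : ∀ (w : List α) (j : ℕ), ∃ w' : List α,
      ∀ q, (fun q => M.evalFrom q w)^[j] q = M.evalFrom q w' := by
    intro w j
    induction j with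
    | zero => exact ⟨[], fun q => rfl⟩
    | succ j ih =>
      obtain ⟨w', hw'⟩ := ih
      refine ⟨w' ++ w, fun q => ?_⟩
      rw [Function.iterate_succ_apply', hw', DFA.evalFrom_of_append]
  have hB : transSemigroup M ⊆ Bsf n (by omega) := by
    rintro t ⟨w, hw, rfl⟩
    refine ⟨?_, hlast w, ?_⟩
    · intro q hq
      obtain ⟨u, hu⟩ := hmin.1 q
      refine h0 (u ++ w) (by simp [hw]) ?_
      rw [DFA.evalFrom_of_append, hu]
      exact congrArg Fin.val hq
    · intro j _
      obtain ⟨w', hw'⟩ := hiter w j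
      simp only [hw']
      by_contra hc
      push Not at hc
      obtain ⟨hc1, q, hq1, _, hq3⟩ := hc
      exact hc1 (hB0 w' q hq1 hq3)
  obtain ⟨W, hW⟩ := aux_full m n hm hn K L hsfK hqK hprod M hacc hempty h0
  have hcol : ∀ p q : Fin n, 0 < p.val → p.val < n - 1 → 0 < q.val → q.val < n - 1 → p ≠ q →
      ∃ u v, u ≠ [] ∧ ((M.evalFrom M.start (u ++ v) = p ∧ M.evalFrom M.start v = q) ∨
        (M.evalFrom M.start (u ++ v) = q ∧ M.evalFrom M.start v = p)) := by
    intro p q hp hp' hq hq' hpq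
    obtain ⟨u1, v1, e1, _, f1⟩ := hW p hp hp'
    obtain ⟨u2, v2, e2, _, f2⟩ := hW q hq hq'
    rcases List.append_eq_append_iff.1 (e1.symm.trans e2) with ⟨a, _, h⟩ | ⟨a, _, h⟩
    · refine ⟨a, v2, ?_, Or.inl ⟨by rw [← h, f1], f2⟩⟩
      rintro rfl
      apply hpq
      rw [← f1, ← f2, h, List.nil_append]
    · refine ⟨a, v1, ?_, Or.inr ⟨by rw [← h, f2], f1⟩⟩
      rintro rfl
      apply hpq
      rw [← f1, ← f2, h, List.nil_append]
  constructor
  · intro t ht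
    refine ⟨hB ht, ?_⟩
    obtain ⟨w, hw, rfl⟩ := ht
    intro p q hpq
    by_contra hc
    push Not at hc
    obtain ⟨hc1, hc2⟩ := hc
    have hpl : M.evalFrom p w ≠ ⟨n - 1, by omega⟩ := fun h => hc1 h (by rw [← hc2]; exact h)
    have hql : M.evalFrom q w ≠ ⟨n - 1, by omega⟩ := fun h => hpl (hc2.trans h)
    have lt : ∀ p : Fin n, M.evalFrom p w ≠ ⟨n - 1, by omega⟩ → p.val < n - 1 := by
      intro p hp
      by_contra h
      apply hp
      have : p = ⟨n - 1, by omega⟩ := Fin.ext (by have := p.isLt; simp only; omega)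
      rw [this]
      exact hlast w
    have pos : ∀ p q : Fin n, p ≠ q → M.evalFrom p w = M.evalFrom q w →
        M.evalFrom p w ≠ ⟨n - 1, by omega⟩ → 0 < p.val := by
      intro p q hpq h hp
      by_contra h0'
      have hp0 : p = ⟨0, by omega⟩ := Fin.ext (by simp only; omega)
      have hq : 0 < q.val := by
        by_contra hq
        exact hpq (Fin.ext (by omega))
      rw [hp0] at h hp
      exact hp (hB0 w q hq h)
    obtain ⟨u, v, hu, ⟨h1, h2⟩ | ⟨h1, h2⟩⟩ := hcol p q (pos p q hpq hc2 hpl) (lt p hpl)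
      (pos q p hpq.symm hc2.symm hql) (lt q hql) hpq
    · have := hmeet u (v ++ w) hu (by
        rw [← List.append_assoc, DFA.evalFrom_of_append, h1, DFA.evalFrom_of_append, h2]
        exact hc2)
      rw [DFA.evalFrom_of_append, h2] at this
      exact hql this
    · have := hmeet u (v ++ w) hu (by
        rw [← List.append_assoc, DFA.evalFrom_of_append, h1, DFA.evalFrom_of_append, h2]
        exact hc2.symm)
      rw [DFA.evalFrom_of_append, h2] at this
      exact hpl this
  · intro hWsf
    have key : ∀ p q : Fin n, 0 < p.val → p.val < n - 1 → 0 < q.val → q.val < n - 1 →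
        ∀ u v, u ≠ [] → M.evalFrom M.start (u ++ v) = p → M.evalFrom M.start v = q → False := by
      intro p q hp hp' hq hq' u v hu h1 h2
      have hv : v ≠ [] := by
        rintro rfl
        rw [DFA.evalFrom_nil, hstart] at h2
        rw [← h2] at hq
        simp at hq
      rw [DFA.evalFrom_of_append] at h1
      rcases (hWsf ⟨v, hv, rfl⟩).2 with h | h
      · simp only at h
        rw [hstart, h] at h2
        rw [← h2] at hq'
        simp at hq'
      · have hr0 := h0 u hu
        have hrl : M.evalFrom M.start u ≠ ⟨n - 1, by omega⟩ := by
          intro h'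
          rw [h', hlast] at h1
          rw [← h1] at hp'
          simp at hp'
        have := (M.evalFrom M.start u).isLt
        rw [Ne, Fin.ext_iff] at hrl
        simp only at hrl
        have h3 := h (M.evalFrom M.start u) (by omega) (by omega)
        simp only at h3
        rw [h3] at h1
        rw [← h1] at hp'
        simp at hp'
    obtain ⟨u, v, hu, ⟨h1, h2⟩ | ⟨h1, h2⟩⟩ := hcol ⟨1, by omega⟩ ⟨2, by omega⟩
      (by simp) (by simp only; omega) (by simp) (by simp only; omega) (by simp [Fin.ext_iff])
    · exact key _ _ (by simp) (by simp only; omega) (by simp) (by simp only; omega) u v hu h1 h2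
    · exact key _ _ (by simp) (by simp only; omega) (by simp) (by simp only; omega) u v hu h1 h2
end
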